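/- arXiv:2010.13473 — 2 statements merged into one kernel-verified Lean document; each statement's English description precedes it below -/
import Mathlib

section
/- Every geometric graph on ℤ² with maximum degree at most 3 has dilation at least 1+√2. That is, if G is a geometric graph on ℤ² in which every vertex has at most 3 neighbors, then there exist distinct points p, q ∈ ℤ² with d_G(p,q) ≥ (1+√2)·|p−q|. -/
open SimpleGraph ENNReal

/-- The point of the Euclidean plane (identified with `ℂ`) corresponding to a lattice point. -/
noncomputable def toC (p : ℤ × ℤ) : ℂ := ⟨(p.1 : ℝ), (p.2 : ℝ)⟩

/-- The Euclidean length of a walk in a geometric graph on `ℤ²`: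
the sum of the Euclidean lengths of its edges. -/
noncomputable def walkLen (G : SimpleGraph (ℤ × ℤ)) :
    ∀ {p q : ℤ × ℤ}, G.Walk p q → ℝ
  | _, _, .nil => 0
  | p, _, .cons (v := v) _ w => dist (toC p) (toC v) + walkLen G w

/-- The graph distance `d_G(p,q)`: infimum of Euclidean lengths of walks from `p` to `q`
(`∞` if there is no walk). -/
noncomputable def gdist (G : SimpleGraph (ℤ × ℤ)) (p q : ℤ × ℤ) : ℝ≥0∞ :=
  ⨅ w : G.Walk p q, ENNReal.ofReal (walkLen G w)

/-- `G` has maximum degree at most `3`. -/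
def MaxDegThree (G : SimpleGraph (ℤ × ℤ)) : Prop :=
  ∀ v : ℤ × ℤ, (G.neighborSet v).encard ≤ 3

/-- `G` is plane: two distinct edges, viewed as closed segments in the plane,
intersect at most in a common endpoint. -/
def IsPlane (G : SimpleGraph (ℤ × ℤ)) : Prop :=
  ∀ a b c d : ℤ × ℤ, G.Adj a b → G.Adj c d → s(a, b) ≠ s(c, d) →
    ∀ x : ℂ, x ∈ segment ℝ (toC a) (toC b) → x ∈ segment ℝ (toC c) (toC d) →
      x ∈ ({toC a, toC b} : Set ℂ) ∧ x ∈ ({toC c, toC d} : Set ℂ)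

/-- `G` is locally optimal. -/
def LocallyOptimal (G : SimpleGraph (ℤ × ℤ)) : Prop :=
  IsPlane G ∧ MaxDegThree G ∧
    ∀ p q : ℤ × ℤ, dist (toC p) (toC q) ≤ Real.sqrt 5 →
      gdist G p q ≤ ENNReal.ofReal ((1 + Real.sqrt 2) * dist (toC p) (toC q))

/-- The dilation of `G`. -/
noncomputable def dil (G : SimpleGraph (ℤ × ℤ)) : ℝ≥0∞ :=
  ⨆ (p : ℤ × ℤ) (q : ℤ × ℤ) (_ : p ≠ q),
    gdist G p q / ENNReal.ofReal (dist (toC p) (toC q))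

theorem dist_toC (p q : ℤ × ℤ) :
    dist (toC p) (toC q) = √(((p.1 - q.1) ^ 2 + (p.2 - q.2) ^ 2 : ℤ) : ℝ) := by
  simp [toC, Complex.dist_eq_re_im]

theorem dist_le_walkLen (G : SimpleGraph (ℤ × ℤ)) {p q : ℤ × ℤ} (w : G.Walk p q) :
    dist (toC p) (toC q) ≤ walkLen G w := by
  induction w with
  | nil => simp [walkLen]
  | cons _ w ih => exact (dist_triangle _ _ _).trans (add_le_add_right ih _)

theorem sqrt_le_dist_toC {k : ℕ} {p q : ℤ × ℤ}
    (h : (k : ℤ) ≤ (p.1 - q.1) ^ 2 + (p.2 - q.2) ^ 2) :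
    √(k : ℝ) ≤ dist (toC p) (toC q) := by
  rw [dist_toC]
  exact Real.sqrt_le_sqrt (by exact_mod_cast h)

theorem one_le_sq_add_sq_of_ne {p q : ℤ × ℤ} (h : p ≠ q) :
    1 ≤ (p.1 - q.1) ^ 2 + (p.2 - q.2) ^ 2 := by
  by_contra! hlt
  refine h (Prod.ext ?_ ?_) <;>
    nlinarith [sq_nonneg (p.1 - q.1), sq_nonneg (p.2 - q.2)]

/-- A detour between two lattice points at unit distance through a third lattice point has length
at least `1 + √2`: by parity, its two parts cannot both have length `1`. -/
theorem one_add_sqrt_two_le_dist_add_dist {p q v : ℤ × ℤ}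
    (hpq : (p.1 - q.1) ^ 2 + (p.2 - q.2) ^ 2 = 1) (hpv : p ≠ v) (hvq : v ≠ q) :
    1 + √2 ≤ dist (toC p) (toC v) + dist (toC v) (toC q) := by
  have h₁ := one_le_sq_add_sq_of_ne hpv
  have h₂ := one_le_sq_add_sq_of_ne hvq
  have hd₁ := sqrt_le_dist_toC (k := 1) (by exact_mod_cast h₁)
  have hd₂ := sqrt_le_dist_toC (k := 1) (by exact_mod_cast h₂)
  have hpar : ¬ ((p.1 - v.1) ^ 2 + (p.2 - v.2) ^ 2 = 1 ∧
      (v.1 - q.1) ^ 2 + (v.2 - q.2) ^ 2 = 1) := by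
    rintro ⟨h₃, h₄⟩
    have : 2 * ((p.1 - v.1) * (v.1 - q.1) + (p.2 - v.2) * (v.2 - q.2)) = -1 := by
      linear_combination hpq - h₃ - h₄
    omega
  rw [Nat.cast_one, Real.sqrt_one] at hd₁ hd₂
  rcases h₁.eq_or_lt with h | h
  · have := sqrt_le_dist_toC (k := 2) (p := v) (q := q) (by push_cast; omega)
    push_cast at this
    linarith
  · have := sqrt_le_dist_toC (k := 2) (p := p) (q := v) (by push_cast; omega)
    push_cast at this
    linarith

theorem one_add_sqrt_two_le_walkLen {G : SimpleGraph (ℤ × ℤ)} {p q : ℤ × ℤ}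
    (hpq : (p.1 - q.1) ^ 2 + (p.2 - q.2) ^ 2 = 1) (hadj : ¬ G.Adj p q) (w : G.Walk p q) :
    1 + √2 ≤ walkLen G w := by
  cases w with
  | nil => simp at hpq
  | @cons _ v _ h w =>
    have hvq : v ≠ q := by
      rintro rfl
      exact hadj h
    exact (one_add_sqrt_two_le_dist_add_dist hpq h.ne hvq).trans
      (add_le_add_right (dist_le_walkLen G w) _)

/-- Every geometric graph on ℤ² with maximum degree at most 3 has dilation at least 1+√2:
there are distinct points p, q with d_G(p,q) ≥ (1+√2)·|p−q|. -/
theorem degree_three_dilation_lower_bound (G : SimpleGraph (ℤ × ℤ)) (hdeg : MaxDegThree G) :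
    ∃ p q : ℤ × ℤ, p ≠ q ∧
      ENNReal.ofReal ((1 + Real.sqrt 2) * dist (toC p) (toC q)) ≤ gdist G p q := by
  by_contra! hlt
  have hadj : ∀ q : ℤ × ℤ, q.1 ^ 2 + q.2 ^ 2 = 1 → q ∈ G.neighborSet 0 := by
    intro q hq
    by_contra hn
    have hq' : ((0 : ℤ × ℤ).1 - q.1) ^ 2 + ((0 : ℤ × ℤ).2 - q.2) ^ 2 = 1 := by simpa using hq
    have hne : (0 : ℤ × ℤ) ≠ q := by
      rintro rfl
      simp at hq
    refine (hlt 0 q hne).not_ge (le_iInf fun w => ENNReal.ofReal_le_ofReal ?_)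
    rw [dist_toC, hq', Int.cast_one, Real.sqrt_one, mul_one]
    exact one_add_sqrt_two_le_walkLen hq' hn w
  have hsub : (({(1, 0), (-1, 0), (0, 1), (0, -1)} : Finset (ℤ × ℤ)) : Set (ℤ × ℤ)) ⊆
      G.neighborSet 0 := by
    intro q hq
    apply hadj
    simp only [Finset.coe_insert, Finset.coe_singleton, Set.mem_insert_iff,
      Set.mem_singleton_iff] at hq
    rcases hq with rfl | rfl | rfl | rfl <;> norm_num
  have hcard := (Set.encard_le_encard hsub).trans (hdeg 0)
  rw [Set.encard_coe_eq_coe_finsetCard] at hcard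
  exact absurd hcard (by decide)
end

section
/- Local-global principle: if G is a locally optimal geometric graph on ℤ² (plane, maximum degree at most 3, and d_G(p,q) ≤ (1+√2)·|p−q| for all p, q ∈ ℤ² with |p−q| ≤ √5), then d_G(p,q) ≤ (1+√2)·|p−q| for ALL p, q ∈ ℤ²; that is, G has dilation at most 1+√2. Consequently the set of locally optimal graphs coincides with the set of plane, maximum-degree-3 geometric graphs on ℤ² of dilation 1+√2. -/
open SimpleGraph ENNReal

namespace LocalOptimality

/-- Evaluate a number before passing it on; this keeps kernel computations eager. -/
def forceNat {α : Type} (n : ℕ) (k : ℕ → α) : α :=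
  match n with
  | 0 => k 0
  | m + 1 => k (m + 1)

def forceNats (l : List ℕ) (k : List ℕ → Bool) : Bool :=
  match l with
  | [] => k []
  | a :: l => forceNat a fun b => forceNats l fun m => k (b :: m)

/-- `List.foldr`, implemented directly by the recursor for the sake of kernel computations. -/
def foldList {α β : Type} (f : α → β → β) (b : β) (l : List α) : β :=
  List.rec (motive := fun _ => β) b (fun a _ ih => f a ih) l

/-- A path pattern: the set of its edges (as a bit mask) and the list of its vertices. -/
abbrev Pattern := ℕ × List ℕ

def forcePatterns (l : List Pattern) (k : List Pattern → Bool) : Bool :=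
  match l with
  | [] => k []
  | (a, vs) :: l => forceNat a fun a' => forceNats vs fun vs' => forcePatterns l fun l' =>
      k ((a', vs') :: l')

def forceTable (l : List (List Pattern)) (k : List (List Pattern) → Bool) : Bool :=
  match l with
  | [] => k []
  | a :: l => forcePatterns a fun b => forceTable l fun m => k (b :: m)

/-- The king moves from the vertex with code `p`: weight, code of the endpoint, edge index. -/
def moves (p : ℕ) : List (ℕ × ℕ × ℕ) :=
  [(5, p + 1, 4 * p), (5, p - 1, 4 * (p - 1)),
   (5, p + 16, 4 * p + 1), (5, p - 16, 4 * (p - 16) + 1),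
   (7, p + 17, 4 * p + 2), (7, p - 17, 4 * (p - 17) + 2),
   (7, p - 15, 4 * (p - 16) + 3), (7, p + 15, 4 * (p - 1) + 3)]

/-- A necessary condition for the existence of a king walk of weight at most `c`. -/
def near (c p q : ℕ) : Bool :=
  let a := p % 16 - q % 16 + (q % 16 - p % 16)
  let b := p / 16 - q / 16 + (q / 16 - p / 16)
  Nat.ble (5 * a + 2 * b) c && Nat.ble (2 * a + 5 * b) c

/-- Patterns of the king walks of weight at most `c` from `p` to `q` that stay in the columns
`1, …, h`; a walk that leaves this region contributes the patterns `dflt`. -/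
def walks (dflt : List Pattern) (h q : ℕ) : ℕ → ℕ → ℕ → ℕ → List ℕ → List Pattern
  | 0, _, _, _, _ => dflt
  | f + 1, c, p, m, vs =>
    bif Nat.beq p q then [(m, p :: vs)] else
    bif Nat.ble 33 p && (Nat.ble 1 (p % 16) && Nat.ble (p % 16) h) then
      (moves p).flatMap fun w =>
        bif Nat.ble w.1 c && near (c - w.1) w.2.1 q then
          forceNat (c - w.1) fun c' => forceNat w.2.1 fun p' =>
            forceNat (Nat.lor m (Nat.shiftLeft 1 w.2.2)) fun m' =>
              walks dflt h q f c' p' m' (p :: vs)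
        else []
    else dflt

/-- The bits `4 * n + 2` with `16 ≤ n < 256` and `n % 16 ≠ 15`. -/
def crossMask : ℕ :=
  2996155224770526510445846815131708119142875735151130898576199966021378156443501447559713181960040177270165173622968087786506420232883900487958146113679026834502997230902061486432226262625551748547636842558437052921883239494395072830393435124975877623183271583942941945436294359569591806360834181534475878400

/-- Change the lowest 64 bits, which carry no information, so that the hash values that the kernel
uses for numerals (their lowest 64 bits) become different for different edge sets. -/
def scramble (U : ℕ) : ℕ := Nat.xor U (Nat.mod U 2305843009213693951)

/-- Whether the edge set `U` contains both diagonals of some unit square. -/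
def hasCrossing (U : ℕ) : Bool :=
  Bool.not (Nat.beq (Nat.land (Nat.land U (Nat.shiftRight U 1)) crossMask) 0)

/-- The number of edges of `U` at the vertex `v + 17`. -/
def degreeAt (U v : ℕ) : ℕ :=
  forceNat (Nat.shiftRight U (Nat.mul 4 v)) fun S =>
    let b (k : ℕ) : ℕ := Nat.land (Nat.shiftRight S k) 1
    Nat.add (b 68) (Nat.add (b 64) (Nat.add (b 69) (Nat.add (b 5)
      (Nat.add (b 70) (Nat.add (b 2) (Nat.add (b 7) (b 67)))))))

def isSubset (m U : ℕ) : Bool := Nat.beq (Nat.land m U) m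

/-- A cheap consistency test for the edge set `U`: it has no edge of `F`, no crossing,
no vertex of degree more than `3` among `s + vs`, and it contains no member of `blk`. -/
def isViable (blk : List Pattern) (F U s : ℕ) (vs : List ℕ) : Bool :=
  Nat.beq (Nat.land U F) 0 && (Bool.not (hasCrossing U) &&
    (foldList (fun v r => (Nat.ble v 32 || Nat.ble (degreeAt U (Nat.add (Nat.sub v 17) s)) 3) && r)
      true vs && foldList (fun b r => Bool.not (isSubset b.1 U) && r) true blk))

/-- The common edges of all viable extensions of `T` by a shifted pattern. -/
def commonEdges (blk : List Pattern) (T F s : ℕ) (l : List Pattern) : ℕ :=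
  foldList (fun t r =>
    forceNat (scramble (Nat.lor T (Nat.shiftLeft t.1 (Nat.mul 4 s)))) fun U =>
      bif isViable blk F U s t.2 then Nat.land U r else r)
    179769313486231590772930519078902473361797697894230657273430081157732675805500963132708477322407536021120113879871393357658789768814416622492847430639474124377767893424865485276302219601246094119453082952085005768838150682342462881473913110540827237163350510684586298239947245938479716304835356329624224137215 l

/-- Remove the patterns that contain a crossing or another pattern. -/
def prune : List Pattern → List Pattern → List Pattern
  | [], acc => acc
  | t :: l, acc =>
    bif hasCrossing t.1 || acc.any (fun u => isSubset u.1 t.1) then prune l acc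
    else prune l (t :: acc)

/-- Displacement code and weight bound of the distance constraints that are used. -/
def constraintTable : List (List Pattern) :=
  [(83, 12), (98, 12), (99, 17), (67, 17), (100, 26), (115, 26), (68, 26), (51, 26)].map fun d =>
    prune (walks [(0, [])] 5 d.1 6 d.2 82 0 []) []

/-- One step of a refutation: use a distance constraint, branch on an edge, or close a branch. -/
inductive Step
  | use (k s : ℕ)
  | branch (i : ℕ)
  | close

/-- Run one step of a refutation on a stack of branches, each given by its present and absent
edges, and continue with `r`. -/
def runStep (tbl : List (List Pattern)) (blk : List Pattern) (o : Step)
    (r : List (ℕ × ℕ) → Bool) : List (ℕ × ℕ) → Bool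
  | [] => false
  | (T, F) :: st =>
    match o with
    | .close => hasCrossing T && r st
    | .branch i =>
      Nat.ble 64 i && forceNat (scramble (Nat.lor T (Nat.shiftLeft 1 i))) fun T' =>
        forceNat (Nat.lor F (Nat.shiftLeft 1 i)) fun F' => r ((T', F) :: (T, F') :: st)
    | .use k s =>
      Nat.ble (s % 16) 9 &&
        forceNat (scramble (commonEdges blk T F s (tbl.getD k [(0, [])]))) fun T' =>
          r ((T', F) :: st)

/-- Run a refutation on a stack of branches. -/
def refutes (tbl : List (List Pattern)) (blk : List Pattern) (l : List Step) :
    List (ℕ × ℕ) → Bool :=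
  foldList (runStep tbl blk) List.isEmpty l

/-- The viable members of a list of patterns, shifted by `s`. -/
def viableStarts (blk : List Pattern) (s : ℕ) : List Pattern → List ℕ
  | [] => []
  | t :: l =>
    forceNat (Nat.shiftLeft t.1 (Nat.mul 4 s)) fun U =>
      bif isViable blk 0 U s t.2 then U :: viableStarts blk s l
      else viableStarts blk s l

/-- A refutation of all viable starts. -/
def refutation : List Step :=
  [.use 2 68, .close, .branch 660, .use 0 82, .close, .branch 601, .use 1 84, .use 1 100,
   .use 2 85, .close, .use 0 83, .use 1 100, .use 1 85, .use 2 68, .close, .use 0 68, .close,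
   .branch 669, .use 1 101, .close, .branch 664, .branch 728, .use 0 101, .branch 609, .use 0 85,
   .branch 737, .branch 610, .use 1 54, .close, .use 0 86, .use 4 85, .use 1 54, .branch 677,
   .branch 614, .use 0 71, .use 1 71, .use 1 88, .close, .use 4 85, .use 6 86, .close, .use 4 85,
   .use 4 87, .use 6 86, .close, .use 5 85, .use 0 70, .use 0 102, .use 0 103, .close, .use 0 85,
   .use 0 68, .close, .use 1 84, .use 0 82, .close, .use 1 85, .use 2 68, .close, .use 2 68,
   .close, .branch 541, .use 1 37, .close, .use 3 69, .use 0 52, .branch 604, .branch 603,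
   .use 0 68, .branch 473, .branch 598, .use 1 84, .close, .use 0 67, .use 4 51, .use 1 84,
   .branch 594, .use 0 82, .use 1 67, .use 4 51, .close, .use 4 51, .use 6 82, .close, .use 5 36,
   .use 1 84, .close, .use 0 68, .use 0 85, .close, .use 1 53, .use 2 69, .close, .use 0 68,
   .close, .branch 541, .use 1 37, .close, .branch 604, .branch 540, .use 0 52, .branch 601,
   .use 0 68, .branch 473, .branch 598, .use 1 84, .close, .use 0 67, .use 4 51, .use 1 84,
   .branch 594, .use 0 82, .use 1 67, .use 4 51, .close, .use 4 51, .use 6 82, .close, .use 5 36,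
   .use 1 84, .close, .use 0 68, .use 0 85, .close, .use 1 54, .use 0 71, .close, .use 1 53,
   .use 2 69, .close, .use 0 68, .close, .branch 608, .use 0 71, .close, .branch 609, .use 1 54,
   .use 2 52, .use 5 37, .close, .use 0 70, .use 1 38, .use 1 53, .use 1 70, .use 2 68, .close,
   .use 0 68, .close, .use 0 85, .close, .use 0 85, .close, .use 0 85, .close, .use 0 85, .close,
   .use 0 85, .close, .use 0 85, .close, .use 0 68, .close, .use 0 68, .close, .branch 602,
   .use 0 85, .close, .branch 600, .use 0 69, .close, .branch 538, .use 1 36, .branch 607,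
   .use 6 69, .use 7 69, .close, .use 0 69, .use 1 38, .close, .use 0 68, .branch 605,
   .branch 543, .use 0 54, .use 1 38, .branch 476, .branch 670, .use 0 85, .branch 732,
   .use 0 102, .use 4 69, .close, .branch 735, .use 0 102, .use 4 69, .close, .branch 675,
   .use 1 102, .close, .branch 674, .use 4 69, .use 5 102, .use 6 100, .use 6 117, .close,
   .branch 613, .branch 611, .use 4 69, .use 1 102, .use 0 103, .branch 549, .use 0 71,
   .use 1 39, .close, .branch 612, .use 1 55, .branch 485, .use 5 38, .use 6 54, .use 7 54,
   .close, .use 3 54, .use 5 38, .use 1 72, .close, .use 1 55, .use 4 54, .use 1 40, .use 5 38,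
   .close, .use 0 70, .use 0 86, .branch 548, .use 2 38, .use 7 54, .use 6 54, .use 1 56, .close,
   .branch 484, .branch 417, .use 2 38, .use 7 54, .use 0 21, .close, .branch 421, .branch 550,
   .use 1 39, .close, .branch 551, .branch 615, .use 1 87, .close, .use 4 54, .use 1 87,
   .use 1 88, .branch 737, .use 0 102, .branch 800, .use 0 117, .close, .branch 801, .use 0 117,
   .use 0 118, .use 1 134, .close, .use 0 118, .use 1 118, .use 1 135, .use 3 133, .use 6 117,
   .close, .use 1 102, .use 0 102, .use 0 119, .close, .use 0 55, .use 1 24, .use 2 38, .close,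
   .use 0 38, .use 7 54, .use 0 40, .close, .use 1 39, .use 6 54, .use 0 38, .use 1 7, .close,
   .use 0 86, .use 6 85, .use 1 102, .use 1 71, .use 1 88, .close, .use 0 85, .branch 613,
   .branch 673, .use 0 86, .use 4 69, .use 5 101, .use 7 133, .close, .branch 674, .use 4 69,
   .use 1 101, .use 1 103, .close, .branch 734, .use 0 101, .use 1 101, .use 1 86, .use 1 87,
   .use 0 118, .close, .branch 735, .branch 728, .use 0 101, .close, .branch 731, .use 0 101,
   .close, .branch 667, .branch 663, .use 1 84, .use 4 83, .use 1 99, .use 4 84, .use 5 84,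
   .close, .branch 662, .branch 732, .branch 660, .branch 724, .use 1 100, .use 5 84, .use 6 97,
   .close, .branch 656, .use 1 67, .use 1 83, .use 0 81, .close, .branch 661, .use 1 67, .close,
   .use 1 83, .use 1 67, .close, .use 1 84, .use 1 100, .close, .use 0 101, .use 1 86, .use 1 87,
   .use 4 84, .use 5 85, .close, .use 1 84, .use 0 83, .use 4 51, .use 5 36, .close, .use 0 100,
   .use 1 117, .close, .use 0 101, .use 1 101, .close, .use 6 85, .use 0 86, .close, .use 1 37,
   .use 2 36, .use 5 36, .use 0 51, .branch 533, .use 1 35, .branch 410, .use 0 37, .close,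
   .use 1 20, .use 4 34, .use 5 19, .use 0 37, .branch 346, .use 0 21, .use 4 37, .close,
   .use 5 19, .use 7 36, .close, .use 0 67, .use 1 84, .close, .use 0 69, .use 1 53, .branch 478,
   .use 0 54, .close, .use 1 37, .use 0 51, .branch 533, .branch 663, .use 0 83, .use 1 84,
   .use 1 99, .branch 669, .use 4 67, .use 4 84, .use 5 84, .close, .use 1 85, .use 4 67, .close,
   .branch 598, .use 1 84, .close, .branch 662, .branch 597, .branch 667, .use 1 85, .use 3 99,
   .close, .branch 660, .use 0 82, .use 1 83, .branch 531, .use 1 35, .close, .use 0 66,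
   .use 6 66, .use 1 35, .use 0 49, .branch 590, .use 1 82, .close, .use 4 65, .use 5 66,
   .use 1 82, .use 3 97, .branch 669, .branch 725, .branch 728, .use 1 100, .use 4 84, .close,
   .branch 730, .use 0 100, .use 1 100, .use 4 84, .use 0 117, .close, .use 0 100, .use 4 84,
   .use 5 84, .use 0 115, .close, .use 5 82, .use 6 99, .close, .use 1 85, .use 2 84, .use 5 82,
   .use 1 100, .use 5 84, .use 6 100, .close, .use 0 83, .use 4 67, .use 1 100, .use 4 84,
   .close, .use 4 67, .use 5 68, .use 0 99, .use 1 67, .close, .use 0 83, .use 1 84, .close,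
   .use 0 67, .use 1 84, .close, .use 1 69, .use 3 85, .close, .use 0 84, .close, .branch 606,
   .use 0 68, .close, .branch 668, .use 0 84, .close, .branch 670, .use 1 102, .branch 603,
   .use 6 99, .use 7 116, .close, .use 0 84, .use 1 100, .close, .use 0 85, .branch 605,
   .branch 667, .use 0 99, .use 1 100, .branch 792, .branch 538, .use 0 68, .branch 536,
   .use 0 51, .use 4 67, .close, .branch 475, .use 0 51, .use 4 67, .close, .branch 535,
   .use 1 36, .close, .branch 534, .use 4 67, .use 5 19, .use 6 51, .use 6 68, .close,
   .branch 597, .branch 599, .use 4 67, .use 1 36, .use 0 50, .branch 661, .use 0 82, .use 1 99,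
   .close, .branch 656, .use 1 83, .branch 725, .use 5 83, .use 6 114, .use 7 131, .close,
   .use 3 115, .use 5 83, .use 1 66, .close, .use 1 83, .use 4 82, .use 1 98, .use 5 83, .close,
   .use 0 67, .use 0 83, .branch 720, .use 2 99, .use 7 131, .use 6 114, .use 1 82, .close,
   .branch 784, .branch 793, .use 2 99, .use 7 131, .use 0 132, .close, .branch 789, .branch 658,
   .use 1 99, .close, .branch 659, .branch 595, .use 1 51, .close, .use 4 82, .use 1 51,
   .use 2 50, .branch 473, .use 0 51, .branch 468, .use 0 36, .close, .branch 409, .use 0 35,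
   .use 0 36, .use 1 4, .close, .use 0 35, .use 0 36, .close, .use 1 36, .use 0 51, .use 0 34,
   .close, .use 0 98, .use 1 114, .use 2 99, .close, .use 0 115, .use 7 131, .use 0 113, .close,
   .use 1 99, .use 6 114, .use 0 115, .use 0 131, .close, .use 0 67, .use 6 83, .use 1 67,
   .use 1 36, .use 2 49, .close, .use 0 68, .branch 597, .branch 537, .use 0 67, .use 4 67,
   .use 5 20, .use 7 52, .close, .branch 534, .use 4 67, .use 1 35, .use 1 37, .close,
   .branch 474, .use 0 52, .use 1 52, .use 1 37, .use 2 51, .use 0 35, .close, .branch 475,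
   .branch 540, .use 0 52, .close, .branch 479, .use 0 52, .close, .branch 543, .branch 547,
   .use 1 54, .use 4 53, .use 1 39, .use 4 52, .use 5 37, .close, .branch 546, .branch 536,
   .branch 608, .branch 544, .use 1 38, .use 5 37, .use 6 71, .close, .branch 612, .use 1 55,
   .use 1 71, .use 0 72, .close, .branch 549, .use 1 71, .close, .use 1 55, .use 1 71, .close,
   .use 1 54, .use 2 37, .close, .use 0 52, .use 1 52, .use 2 51, .use 4 52, .use 5 4, .close,
   .use 1 54, .use 0 70, .use 4 85, .use 5 85, .close, .use 0 53, .use 1 21, .close, .use 0 52,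
   .use 1 37, .close, .use 6 83, .use 0 67, .close, .use 1 101, .use 1 102, .use 5 85,
   .use 0 102, .branch 677, .use 1 103, .branch 798, .use 0 116, .close, .use 1 118, .use 4 102,
   .use 5 102, .use 0 116, .branch 862, .use 0 132, .use 4 99, .close, .use 5 102, .use 7 149,
   .close, .use 0 86, .use 1 54, .close, .use 0 84, .use 1 85, .branch 730, .use 0 99, .close,
   .use 1 101, .use 0 102, .branch 677, .branch 547, .use 0 70, .use 1 54, .use 1 39,
   .branch 541, .use 4 69, .use 5 37, .use 4 52, .close, .use 1 53, .use 4 69, .close,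
   .branch 610, .use 1 54, .close, .branch 546, .branch 613, .branch 543, .use 1 53, .use 1 54,
   .use 1 55, .close, .branch 608, .use 0 71, .use 1 55, .branch 679, .use 1 103, .close,
   .use 0 87, .use 6 102, .use 1 103, .use 0 104, .branch 618, .use 1 56, .close, .use 4 71,
   .use 5 55, .use 1 56, .use 1 57, .branch 541, .branch 485, .branch 540, .use 1 38, .use 4 52,
   .close, .branch 478, .use 0 53, .use 1 38, .use 4 52, .use 0 36, .close, .use 0 53, .use 4 52,
   .use 5 37, .use 0 38, .close, .use 5 39, .use 6 69, .close, .use 1 53, .use 2 53, .use 5 39,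
   .use 1 38, .use 5 37, .use 6 67, .close, .use 0 70, .use 4 69, .use 1 38, .use 4 52, .close,
   .use 4 69, .use 5 53, .use 0 54, .use 1 71, .close, .use 0 70, .use 1 54, .close, .use 0 86,
   .use 1 54, .close, .use 1 69, .use 3 84, .close, .use 0 68, .close, .use 0 85, .close,
   .use 0 68, .close, .use 0 68, .close, .branch 669, .use 1 101, .close, .use 3 100, .use 0 101,
   .branch 664, .branch 607, .use 0 85, .branch 737, .branch 610, .use 1 54, .close, .use 0 86,
   .use 4 85, .use 1 54, .branch 677, .branch 614, .use 0 71, .use 1 71, .use 1 88, .close,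
   .use 4 85, .use 6 86, .close, .use 4 85, .use 4 87, .use 6 86, .close, .use 5 85, .use 0 70,
   .use 0 102, .use 0 103, .close, .use 0 85, .use 0 68, .close, .use 1 85, .use 2 68, .close,
   .use 1 68, .close, .use 2 69, .close, .use 2 69, .close, .use 0 69, .close, .use 0 85, .close,
   .use 1 70, .close]

/-- The king walks of weight at most `22` from `(6, 9)` to `(8, 10)`. -/
def blockedPatterns : List Pattern := prune (walks [] 14 168 5 22 150 0 []) []

/-- The constraint from `(6, 9)` to `(8, 10)`, without walks of weight at most `22` between these
points, is refuted. -/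
def checkAll : Bool :=
  forceTable constraintTable fun tbl =>
    forcePatterns blockedPatterns fun blk =>
      forceNats (viableStarts blk 68 (tbl.getD 4 [(0, [])])) fun st =>
        refutes tbl blk refutation (st.map fun T => (T, 0))

set_option maxRecDepth 100000 in
theorem checkAll_eq_true : checkAll = true := by decide +kernel

/-- The squared Euclidean distance of two lattice points. -/
def distSq (p q : ℤ × ℤ) : ℤ := (p.1 - q.1) ^ 2 + (p.2 - q.2) ^ 2

/-- The integer weight of a king move: `5` for a unit step, `7` for a diagonal one. -/
def moveWeight (p q : ℤ × ℤ) : ℕ := if distSq p q = 1 then 5 else 7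

/-- There is a walk of weight at most `c` from `p` to `q`. -/
inductive Reach (A : ℤ × ℤ → ℤ × ℤ → Prop) : ℕ → ℤ × ℤ → ℤ × ℤ → Prop
  | refl (c : ℕ) (p : ℤ × ℤ) : Reach A c p p
  | step {c c' : ℕ} {p r q : ℤ × ℤ} (h : A p r) (hc : moveWeight p r + c' ≤ c)
      (hr : Reach A c' r q) : Reach A c p q

/-- The combinatorial properties of the adjacency relation of a locally optimal graph. -/
structure IsGood (A : ℤ × ℤ → ℤ × ℤ → Prop) : Prop where
  symm : ∀ {p q}, A p q → A q p
  king : ∀ {p q}, A p q → distSq p q = 1 ∨ distSq p q = 2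
  degree : ∀ p (l : List (ℤ × ℤ)), l.Nodup → (∀ r ∈ l, A p r) → l.length ≤ 3
  cross : ∀ {p q r s}, A p q → A r s → p + q = r + s → p ≠ r → p ≠ s → False
  reach_one : ∀ {p q}, distSq p q = 1 → Reach A 12 p q
  reach_two : ∀ {p q}, distSq p q = 2 → Reach A 17 p q
  reach_five : ∀ {p q}, distSq p q = 5 → Reach A 26 p q

theorem Reach.mono {A : ℤ × ℤ → ℤ × ℤ → Prop} {c d : ℕ} {p q : ℤ × ℤ} (h : Reach A c p q)
    (hcd : c ≤ d) : Reach A d p q := by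
  cases h with
  | refl => exact .refl _ _
  | step h hc hr => exact .step h (hc.trans hcd) hr

theorem Reach.comp {A : ℤ × ℤ → ℤ × ℤ → Prop} {φ : ℤ × ℤ → ℤ × ℤ}
    (hd : ∀ p q, distSq (φ p) (φ q) = distSq p q) (hs : φ.Surjective) (hi : φ.Injective)
    {c : ℕ} {p q : ℤ × ℤ} (h : Reach A c (φ p) (φ q)) : Reach (fun p q => A (φ p) (φ q)) c p q := by
  generalize ha : φ p = a at h
  generalize hb : φ q = b at h
  induction h generalizing p with
  | refl c x => obtain rfl := hi (ha.trans hb.symm); exact .refl _ _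
  | @step c c' x r y h hc hr ih =>
    obtain ⟨r, rfl⟩ := hs r
    subst ha
    refine .step (r := r) h ?_ (ih rfl hb)
    simpa only [moveWeight, hd] using hc

theorem Reach.of_comp {A : ℤ × ℤ → ℤ × ℤ → Prop} {φ : ℤ × ℤ → ℤ × ℤ}
    (hd : ∀ p q, distSq (φ p) (φ q) = distSq p q)
    {c : ℕ} {p q : ℤ × ℤ} (h : Reach (fun p q => A (φ p) (φ q)) c p q) : Reach A c (φ p) (φ q) := by
  induction h with
  | refl c x => exact .refl _ _
  | step h hc hr ih => exact .step h (by simpa only [moveWeight, hd] using hc) ih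

theorem IsGood.comp {A : ℤ × ℤ → ℤ × ℤ → Prop} (hA : IsGood A) {φ : ℤ × ℤ → ℤ × ℤ}
    (hd : ∀ p q, distSq (φ p) (φ q) = distSq p q) (hs : φ.Surjective) (hi : φ.Injective)
    (ha : ∀ (N m k : ℤ) p q r s, (N - m) • p + m • q = (N - k) • r + k • s →
      (N - m) • φ p + m • φ q = (N - k) • φ r + k • φ s) :
    IsGood fun p q => A (φ p) (φ q) where
  symm h := hA.symm h
  king h := by simpa only [hd] using hA.king h
  degree p l hl h := by
    have := hA.degree (φ p) (l.map φ) (hl.map hi) (List.forall_mem_map.2 h)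
    simpa using this
  cross h h' e h1 h2 := by
    refine hA.cross h h' ?_ (hi.ne h1) (hi.ne h2)
    simpa using ha 2 1 1 _ _ _ _ (by simpa using e)
  reach_one h := (hA.reach_one ((hd _ _).trans h)).comp hd hs hi
  reach_two h := (hA.reach_two ((hd _ _).trans h)).comp hd hs hi
  reach_five h := (hA.reach_five ((hd _ _).trans h)).comp hd hs hi

/-- Properties that follow from being of the form `(x, y) ↦ (u + e x, v + f y)` or
`(x, y) ↦ (u + e y, v + f x)` with signs `e` and `f`. -/
theorem isometry_props {φ : ℤ × ℤ → ℤ × ℤ} {u v e f : ℤ} (he : e ^ 2 = 1) (hf : f ^ 2 = 1)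
    (h : (∀ p, φ p = (u + e * p.1, v + f * p.2)) ∨ ∀ p, φ p = (u + e * p.2, v + f * p.1)) :
    (∀ p q, distSq (φ p) (φ q) = distSq p q) ∧ φ.Surjective ∧ φ.Injective ∧
      ∀ (N m k : ℤ) p q r s, (N - m) • p + m • q = (N - k) • r + k • s →
        (N - m) • φ p + m • φ q = (N - k) • φ r + k • φ s := by
  have key : ∀ p q, distSq (φ p) (φ q) = distSq p q := by
    rintro ⟨x, y⟩ ⟨z, w⟩
    rcases h with h | h
    · simp only [h, distSq]
      linear_combination (x - z) ^ 2 * he + (y - w) ^ 2 * hf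
    · simp only [h, distSq]
      linear_combination (y - w) ^ 2 * he + (x - z) ^ 2 * hf
  refine ⟨key, ?_, ?_, ?_⟩
  · rintro ⟨x, y⟩
    rcases h with h | h
    · refine ⟨(e * (x - u), f * (y - v)), ?_⟩
      rw [h, Prod.mk.injEq]
      exact ⟨by linear_combination (x - u) * he, by linear_combination (y - v) * hf⟩
    · refine ⟨(f * (y - v), e * (x - u)), ?_⟩
      rw [h, Prod.mk.injEq]
      exact ⟨by linear_combination (x - u) * he, by linear_combination (y - v) * hf⟩
  · rintro ⟨x, y⟩ ⟨z, w⟩ hpq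
    have := key (x, y) (z, w)
    rw [hpq] at this
    simp only [distSq, sub_self] at this
    ext
    · simp only; nlinarith [sq_nonneg (x - z), sq_nonneg (y - w)]
    · simp only; nlinarith [sq_nonneg (x - z), sq_nonneg (y - w)]
  · rintro N m k ⟨a, b⟩ ⟨c, d⟩ ⟨a', b'⟩ ⟨c', d'⟩ hs
    simp only [Prod.smul_mk, smul_eq_mul, Prod.mk_add_mk, Prod.mk.injEq] at hs
    rcases h with h | h <;>
      simp only [h, Prod.smul_mk, smul_eq_mul, Prod.mk_add_mk, Prod.mk.injEq]
    · exact ⟨by linear_combination e * hs.1, by linear_combination f * hs.2⟩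
    · exact ⟨by linear_combination e * hs.2, by linear_combination f * hs.1⟩

/-- The weight of a king walk bounds the octile distance of its endpoints. -/
theorem Reach.abs_le {A : ℤ × ℤ → ℤ × ℤ → Prop} (hA : IsGood A) {c : ℕ} {p q : ℤ × ℤ}
    (h : Reach A c p q) :
    5 * |p.1 - q.1| + 2 * |p.2 - q.2| ≤ c ∧ 2 * |p.1 - q.1| + 5 * |p.2 - q.2| ≤ c := by
  induction h with
  | refl c p => simp
  | @step c c' p r q h hc hr ih =>
    obtain ⟨x, y⟩ := p
    obtain ⟨z, w⟩ := r
    obtain ⟨a, b⟩ := q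
    have hk := hA.king h
    simp only [moveWeight, distSq] at hk hc ih ⊢
    obtain ⟨d, rfl⟩ : ∃ d, z = x + d := ⟨z - x, by ring⟩
    obtain ⟨e, rfl⟩ : ∃ e, w = y + e := ⟨w - y, by ring⟩
    have hle : d ^ 2 + e ^ 2 ≤ 2 := by rcases hk with hk | hk <;> nlinarith
    have hd : -1 ≤ d ∧ d ≤ 1 := by constructor <;> nlinarith [sq_nonneg e]
    have he : -1 ≤ e ∧ e ≤ 1 := by constructor <;> nlinarith [sq_nonneg d]
    obtain ⟨hd1, hd2⟩ := hd
    obtain ⟨he1, he2⟩ := he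
    interval_cases d <;> interval_cases e <;> simp at hk hc <;>
      (simp only [abs_eq_max_neg] at *; omega)

theorem forceNat_eq {α : Type} (n : ℕ) (k : ℕ → α) : forceNat n k = k n := by
  cases n <;> rfl

theorem forceNats_eq (l : List ℕ) (k : List ℕ → Bool) : forceNats l k = k l := by
  induction l generalizing k with
  | nil => rfl
  | cons a l ih => simp only [forceNats, forceNat_eq, ih]

theorem forcePatterns_eq (l : List Pattern) (k : List Pattern → Bool) :
    forcePatterns l k = k l := by
  induction l generalizing k with
  | nil => rfl
  | cons a l ih => simp only [forcePatterns, forceNat_eq, forceNats_eq, ih]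

theorem forceTable_eq (l : List (List Pattern)) (k : List (List Pattern) → Bool) :
    forceTable l k = k l := by
  induction l generalizing k with
  | nil => rfl
  | cons a l ih => simp only [forceTable, forcePatterns_eq, ih]

/-- The lattice point with code `n`. -/
def pt (n : ℕ) : ℤ × ℤ := ((n % 16 : ℕ), (n / 16 : ℕ))

theorem pt_injective : pt.Injective := by
  intro a b h
  simp only [pt, Prod.mk.injEq] at h
  omega

theorem pt_add {n s : ℕ} (h : n % 16 + s % 16 < 16) : pt (n + s) = pt n + pt s := by
  simp only [pt, Prod.mk_add_mk, Prod.mk.injEq]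
  omega

/-- The endpoints of the edge with index `i`. -/
def edgeEnds (i : ℕ) : ℕ × ℕ :=
  match i % 4 with
  | 0 => (i / 4, i / 4 + 1)
  | 1 => (i / 4, i / 4 + 16)
  | 2 => (i / 4, i / 4 + 17)
  | _ => (i / 4 + 16, i / 4 + 1)

/-- The edge with index `i` is present. -/
def HasEdge (A : ℤ × ℤ → ℤ × ℤ → Prop) (i : ℕ) : Prop := A (pt (edgeEnds i).1) (pt (edgeEnds i).2)

/-- All edges of the set coded by `U` are present. -/
def HasEdges (A : ℤ × ℤ → ℤ × ℤ → Prop) (U : ℕ) : Prop :=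
  ∀ i, 64 ≤ i → U.testBit i → HasEdge A i

/-- None of the edges of the set coded by `F` is present. -/
def AvoidsEdges (A : ℤ × ℤ → ℤ × ℤ → Prop) (F : ℕ) : Prop :=
  ∀ i, F.testBit i → 64 ≤ i ∧ ¬ HasEdge A i

/-- All edges of the pattern coded by `m` are present and lie in the columns `0, …, h + 1`. -/
def HasPattern (A : ℤ × ℤ → ℤ × ℤ → Prop) (h m : ℕ) : Prop :=
  ∀ i, m.testBit i → 64 ≤ i ∧ i / 4 % 16 ≤ h ∧ HasEdge A i

section

variable {A : ℤ × ℤ → ℤ × ℤ → Prop}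

theorem HasPattern.hasEdges {h m : ℕ} (H : HasPattern A h m) : HasEdges A m :=
  fun i _ hm => (H i hm).2.2

theorem hasPattern_zero (h : ℕ) : HasPattern A h 0 := fun i hi => by simp at hi

theorem avoidsEdges_zero : AvoidsEdges A 0 := fun i hi => by simp at hi

theorem testBit_of_isSubset {m U : ℕ} (h : isSubset m U = true) {i : ℕ} (hi : m.testBit i) :
    U.testBit i := by
  have h' : m &&& U = m := Nat.eq_of_beq_eq_true h
  rw [← h', Nat.testBit_and, Bool.and_eq_true] at hi
  exact hi.2

theorem testBit_scramble {U i : ℕ} (hi : 64 ≤ i) : (scramble U).testBit i = U.testBit i := by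
  have h : (U % 2305843009213693951).testBit i = false :=
    Nat.testBit_lt_two_pow (((Nat.mod_lt _ (by norm_num)).trans (by norm_num : _ < 2 ^ 64)).trans_le
      (Nat.pow_le_pow_right (by norm_num) hi))
  change (U ^^^ (U % 2305843009213693951)).testBit i = _
  rw [Nat.testBit_xor, h, Bool.xor_false]

theorem hasEdges_scramble {U : ℕ} (h : HasEdges A U) : HasEdges A (scramble U) :=
  fun i hi hU => h i hi (by rwa [testBit_scramble hi] at hU)

theorem HasEdges.lor {U V : ℕ} (hU : HasEdges A U) (hV : HasEdges A V) :
    HasEdges A (Nat.lor U V) := by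
  intro i hi h
  change (U ||| V).testBit i = true at h
  rw [Nat.testBit_or, Bool.or_eq_true] at h
  exact h.elim (hU i hi) (hV i hi)

theorem testBit_one_shiftLeft {i j : ℕ} (h : (Nat.shiftLeft 1 i).testBit j) : j = i := by
  change (1 <<< i).testBit j = true at h
  rw [Nat.testBit_shiftLeft, Bool.and_eq_true, Nat.testBit_one_eq_true_iff_self_eq_zero,
    decide_eq_true_eq] at h
  omega

theorem HasEdge.hasEdges {i : ℕ} (h : HasEdge A i) : HasEdges A (Nat.shiftLeft 1 i) := by
  intro j _ hj
  rwa [testBit_one_shiftLeft hj]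

set_option exponentiation.threshold 1024 in
theorem testBit_crossMask {i : ℕ} (h : crossMask.testBit i) :
    64 ≤ i ∧ i % 4 = 2 ∧ i / 4 % 16 ≠ 15 := by
  by_cases hi : i < 1024
  · have key : ∀ i < 1024, crossMask.testBit i → 64 ≤ i ∧ i % 4 = 2 ∧ i / 4 % 16 ≠ 15 := by
      decide +kernel
    exact key i hi h
  · rw [Nat.testBit_lt_two_pow
      ((by decide +kernel : crossMask < 2 ^ 1024).trans_le
        (Nat.pow_le_pow_right (by norm_num) (not_lt.1 hi)))] at h
    exact absurd h (by simp)

theorem HasEdges.not_hasCrossing (hA : IsGood A) {U : ℕ} (hU : HasEdges A U) :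
    hasCrossing U = false := by
  by_contra hc
  simp only [hasCrossing, Bool.not_eq_false] at hc
  have hc' : (U &&& (U >>> 1)) &&& crossMask ≠ 0 := by
    intro h
    have : Nat.beq ((U &&& (U >>> 1)) &&& crossMask) 0 = true := by rw [h]; rfl
    have hc'' : Nat.beq ((U &&& (U >>> 1)) &&& crossMask) 0 = false := by simpa using hc
    simp [this] at hc''
  obtain ⟨i, hi⟩ := Nat.exists_testBit_of_ne_zero hc'
  rw [Nat.testBit_and, Nat.testBit_and, Nat.testBit_shiftRight, Bool.and_eq_true,
    Bool.and_eq_true] at hi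
  obtain ⟨⟨h1, h2⟩, h3⟩ := hi
  obtain ⟨h4, h5, h6⟩ := testBit_crossMask h3
  have e1 := hU i h4 h1
  have e2 := hU (1 + i) (by omega) h2
  have h7 : (1 + i) % 4 = 3 := by omega
  have h8 : (1 + i) / 4 = i / 4 := by omega
  simp only [HasEdge, edgeEnds, h5, h7, h8] at e1 e2
  refine hA.cross e1 e2 ?_ ?_ ?_ <;> simp only [pt, Prod.mk_add_mk, ne_eq, Prod.mk.injEq] <;> omega

/-- For each neighbour of the vertex `v + 17`: the position of the corresponding edge relative to
`4 * v`, and the code of the neighbour relative to `v`. -/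
def neighbourTable : List (ℕ × ℕ) :=
  [(68, 18), (64, 16), (69, 33), (5, 1), (70, 34), (2, 0), (7, 2), (67, 32)]

theorem neighbourTable_hasEdge (hA : IsGood A) {v : ℕ} {w : ℕ × ℕ} (hw : w ∈ neighbourTable)
    (h : HasEdge A (4 * v + w.1)) : A (pt (v + 17)) (pt (v + w.2)) := by
  simp only [neighbourTable, List.mem_cons, List.not_mem_nil, or_false] at hw
  rcases hw with rfl | rfl | rfl | rfl | rfl | rfl | rfl | rfl <;>
    simp only [HasEdge, edgeEnds, Nat.mul_add_mod, Nat.mul_add_div (by norm_num : 4 > 0)] at h <;>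
    norm_num at h
  exacts [h, hA.symm h, h, hA.symm h, h, hA.symm h, h, hA.symm h]

theorem degreeAt_eq (U v : ℕ) :
    degreeAt U v = (neighbourTable.filter fun w => U.testBit (4 * v + w.1)).length := by
  have hb (k : ℕ) : Nat.land (Nat.shiftRight (Nat.shiftRight U (Nat.mul 4 v)) k) 1 =
      (U.testBit (4 * v + k)).toNat := by
    change ((U >>> (4 * v)) >>> k) &&& 1 = _
    rw [← Nat.shiftRight_add, Nat.and_one_is_mod, Nat.toNat_testBit, Nat.shiftRight_eq_div_pow]
  have hf (a : ℕ × ℕ) (l : List (ℕ × ℕ)) (f : ℕ × ℕ → Bool) :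
      ((a :: l).filter f).length = (f a).toNat + (l.filter f).length := by
    rw [List.filter_cons]
    cases h : f a <;> simp [add_comm]
  simp only [degreeAt, forceNat_eq, hb, neighbourTable, hf, List.filter_nil, List.length_nil]
  rfl

theorem HasEdges.degreeAt_le (hA : IsGood A) {U : ℕ} (hU : HasEdges A U) {v : ℕ} (hv : 16 ≤ v) :
    degreeAt U v ≤ 3 := by
  rw [degreeAt_eq]
  have := hA.degree (pt (v + 17))
    ((neighbourTable.filter fun w => U.testBit (4 * v + w.1)).map fun w => pt (v + w.2)) ?_ ?_
  · simpa using this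
  · have : (neighbourTable.map Prod.snd).Nodup := by decide
    have h2 : ((neighbourTable.filter fun w => U.testBit (4 * v + w.1)).map Prod.snd).Nodup :=
      this.sublist (List.filter_sublist.map _)
    have h3 := h2.map (f := fun n => pt (v + n)) fun a b h => Nat.add_left_cancel (pt_injective h)
    simpa [List.map_map, Function.comp_def] using h3
  · rw [List.forall_mem_map]
    intro w hw
    rw [List.mem_filter] at hw
    exact neighbourTable_hasEdge hA hw.1 (hU _ (by omega) hw.2)

theorem foldList_and {α : Type} (f : α → Bool) (l : List α) :
    foldList (fun a r => f a && r) true l = l.all f := by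
  induction l with
  | nil => rfl
  | cons a l ih => rw [List.all_cons, ← ih]; rfl

theorem isViable_of_hasEdges (hA : IsGood A) {blk : List Pattern}
    (hblk : ∀ b ∈ blk, ¬ HasEdges A b.1) {F U : ℕ} (hF : AvoidsEdges A F) (hU : HasEdges A U)
    (s : ℕ) (vs : List ℕ) : isViable blk F U s vs = true := by
  have hFU : Nat.beq (Nat.land U F) 0 = true := by
    have : U &&& F = 0 := by
      by_contra h
      obtain ⟨i, hi⟩ := Nat.exists_testBit_of_ne_zero h
      rw [Nat.testBit_and, Bool.and_eq_true] at hi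
      exact (hF i hi.2).2 (hU i (hF i hi.2).1 hi.1)
    change Nat.beq (U &&& F) 0 = true
    rw [this]
    rfl
  rw [isViable, hFU, hU.not_hasCrossing hA,
    foldList_and (fun v => Nat.ble v 32 || Nat.ble (degreeAt U (Nat.add (Nat.sub v 17) s)) 3),
    foldList_and fun b : Pattern => Bool.not (isSubset b.1 U)]
  simp only [Bool.not_false, Bool.true_and, Bool.and_eq_true, List.all_eq_true, Bool.or_eq_true,
    Nat.ble_eq]
  refine ⟨fun v _ => ?_, fun b hb => ?_⟩
  · by_cases hv : v ≤ 32
    · exact .inl hv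
    · refine .inr (hU.degreeAt_le hA ?_)
      change 16 ≤ v - 17 + s
      omega
  · by_contra h
    rw [Bool.not_eq_true, Bool.not_eq_false'] at h
    exact hblk b hb fun i hi hm => hU i hi (testBit_of_isSubset h hm)

theorem mem_of_mem_prune {t : Pattern} :
    ∀ {l acc : List Pattern}, t ∈ prune l acc → t ∈ l ∨ t ∈ acc
  | [], _, h => .inr h
  | u :: l, acc, h => by
    rw [prune] at h
    cases hc : hasCrossing u.1 || acc.any fun v => isSubset v.1 u.1 <;> rw [hc] at h
    · rcases mem_of_mem_prune h with h | h
      · exact .inl (List.mem_cons_of_mem _ h)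
      · rw [List.mem_cons] at h ⊢
        tauto
    · exact (mem_of_mem_prune h).imp_left (List.mem_cons_of_mem _)

theorem exists_mem_prune (hA : IsGood A) {h : ℕ} {l acc : List Pattern}
    (H : ∃ t, (t ∈ l ∨ t ∈ acc) ∧ HasPattern A h t.1) : ∃ t ∈ prune l acc, HasPattern A h t.1 := by
  induction l generalizing acc with
  | nil => simpa [prune] using H
  | cons u l ih =>
    obtain ⟨t, ht, hp⟩ := H
    rw [prune]
    cases hc : hasCrossing u.1 || acc.any fun v => isSubset v.1 u.1
    · refine ih ⟨t, ?_, hp⟩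
      rw [List.mem_cons] at ht ⊢
      tauto
    · refine ih ?_
      rw [List.mem_cons, or_assoc] at ht
      rcases ht with rfl | ht
      · rw [hp.hasEdges.not_hasCrossing hA, Bool.false_or, List.any_eq_true] at hc
        obtain ⟨v, hv, hs⟩ := hc
        exact ⟨v, .inr hv, fun i hi => hp i (testBit_of_isSubset hs hi)⟩
      · exact ⟨t, ht, hp⟩

end

section

variable {A : ℤ × ℤ → ℤ × ℤ → Prop}

theorem mem_moves {p : ℕ} {w : ℕ × ℕ × ℕ} : w ∈ moves p ↔
    w = (5, p + 1, 4 * p) ∨ w = (5, p - 1, 4 * (p - 1)) ∨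
    w = (5, p + 16, 4 * p + 1) ∨ w = (5, p - 16, 4 * (p - 16) + 1) ∨
    w = (7, p + 17, 4 * p + 2) ∨ w = (7, p - 17, 4 * (p - 17) + 2) ∨
    w = (7, p - 15, 4 * (p - 16) + 3) ∨ w = (7, p + 15, 4 * (p - 1) + 3) := by
  simp [moves]

theorem moveWeight_of_sub {p q d : ℤ × ℤ} (h : p - q = d) :
    moveWeight p q = if d.1 ^ 2 + d.2 ^ 2 = 1 then 5 else 7 := by
  subst h
  rfl

theorem moveWeight_moves {p : ℕ} (hp : 33 ≤ p) (h1 : 1 ≤ p % 16) (h2 : p % 16 ≤ 14)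
    {w : ℕ × ℕ × ℕ} (hw : w ∈ moves p) : moveWeight (pt p) (pt w.2.1) = w.1 := by
  have key (q : ℕ) (d : ℤ × ℤ) (hx : ((p % 16 : ℕ) : ℤ) - (q % 16 : ℕ) = d.1)
      (hy : ((p / 16 : ℕ) : ℤ) - (q / 16 : ℕ) = d.2) :
      moveWeight (pt p) (pt q) = if d.1 ^ 2 + d.2 ^ 2 = 1 then 5 else 7 :=
    moveWeight_of_sub (Prod.ext hx hy)
  rw [mem_moves] at hw
  rcases hw with rfl | rfl | rfl | rfl | rfl | rfl | rfl | rfl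
  · exact key (p + 1) (-1, 0) (by simp only; omega) (by simp only; omega)
  · exact key (p - 1) (1, 0) (by simp only; omega) (by simp only; omega)
  · exact key (p + 16) (0, -1) (by simp only; omega) (by simp only; omega)
  · exact key (p - 16) (0, 1) (by simp only; omega) (by simp only; omega)
  · exact key (p + 17) (-1, -1) (by simp only; omega) (by simp only; omega)
  · exact key (p - 17) (1, 1) (by simp only; omega) (by simp only; omega)
  · exact key (p - 15) (-1, 1) (by simp only; omega) (by simp only; omega)
  · exact key (p + 15) (1, -1) (by simp only; omega) (by simp only; omega)

theorem hasEdge_moves (hA : IsGood A) {p : ℕ} (hp : 33 ≤ p) {w : ℕ × ℕ × ℕ} (hw : w ∈ moves p) :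
    HasEdge A w.2.2 ↔ A (pt p) (pt w.2.1) := by
  have hs (x y : ℤ × ℤ) : A x y ↔ A y x := ⟨hA.symm, hA.symm⟩
  have key0 (n : ℕ) : edgeEnds (4 * n) = (n, n + 1) := by
    simp [edgeEnds]
  have key1 (n : ℕ) : edgeEnds (4 * n + 1) = (n, n + 16) := by
    simp [edgeEnds, Nat.mul_add_div]
  have key2 (n : ℕ) : edgeEnds (4 * n + 2) = (n, n + 17) := by
    simp [edgeEnds, Nat.mul_add_div]
  have key3 (n : ℕ) : edgeEnds (4 * n + 3) = (n + 16, n + 1) := by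
    simp [edgeEnds, Nat.mul_add_div]
  rw [mem_moves] at hw
  rcases hw with rfl | rfl | rfl | rfl | rfl | rfl | rfl | rfl <;>
    simp only [HasEdge, key0, key1, key2, key3]
  · rw [hs, Nat.sub_add_cancel (by omega)]
  · rw [hs, Nat.sub_add_cancel (by omega)]
  · rw [hs, Nat.sub_add_cancel (by omega)]
  · rw [Nat.sub_add_cancel (by omega), show p - 16 + 1 = p - 15 by omega]
  · rw [hs, Nat.sub_add_cancel (by omega), show p - 1 + 16 = p + 15 by omega]

theorem index_moves {p : ℕ} (hp : 33 ≤ p) (h1 : 1 ≤ p % 16) {w : ℕ × ℕ × ℕ} (hw : w ∈ moves p) :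
    64 ≤ w.2.2 ∧ w.2.2 / 4 % 16 ≤ p % 16 := by
  rw [mem_moves] at hw
  rcases hw with rfl | rfl | rfl | rfl | rfl | rfl | rfl | rfl <;> (simp only; omega)

theorem exists_mem_moves {p : ℕ} (hp : 33 ≤ p) (h1 : 1 ≤ p % 16) (h2 : p % 16 ≤ 14) {r : ℤ × ℤ}
    (h : distSq (pt p) r = 1 ∨ distSq (pt p) r = 2) : ∃ w ∈ moves p, r = pt w.2.1 := by
  obtain ⟨x, y⟩ := r
  simp only [distSq, pt] at h
  obtain ⟨d, rfl⟩ : ∃ d, x = (p % 16 : ℕ) + d := ⟨x - (p % 16 : ℕ), by ring⟩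
  obtain ⟨e, rfl⟩ : ∃ e, y = (p / 16 : ℕ) + e := ⟨y - (p / 16 : ℕ), by ring⟩
  simp only [sub_add_cancel_left, neg_sq] at h
  have hd : -1 ≤ d ∧ d ≤ 1 := by constructor <;> rcases h with h | h <;> nlinarith [sq_nonneg e]
  have he : -1 ≤ e ∧ e ≤ 1 := by constructor <;> rcases h with h | h <;> nlinarith [sq_nonneg d]
  obtain ⟨hd1, hd2⟩ := hd
  obtain ⟨he1, he2⟩ := he
  have key (c q j : ℕ) (hw : (c, q, j) ∈ moves p) (ha : ((p % 16 : ℕ) : ℤ) + d = (q % 16 : ℕ))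
      (hb : ((p / 16 : ℕ) : ℤ) + e = (q / 16 : ℕ)) :
      ∃ w ∈ moves p, (((p % 16 : ℕ) : ℤ) + d, ((p / 16 : ℕ) : ℤ) + e) = pt w.2.1 :=
    ⟨(c, q, j), hw, Prod.ext ha hb⟩
  interval_cases d <;> interval_cases e <;> norm_num at h
  · exact key 7 (p - 17) (4 * (p - 17) + 2) (by simp [moves]) (by omega) (by omega)
  · exact key 5 (p - 1) (4 * (p - 1)) (by simp [moves]) (by omega) (by omega)
  · exact key 7 (p + 15) (4 * (p - 1) + 3) (by simp [moves]) (by omega) (by omega)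
  · exact key 5 (p - 16) (4 * (p - 16) + 1) (by simp [moves]) (by omega) (by omega)
  · exact key 5 (p + 16) (4 * p + 1) (by simp [moves]) (by omega) (by omega)
  · exact key 7 (p - 15) (4 * (p - 16) + 3) (by simp [moves]) (by omega) (by omega)
  · exact key 5 (p + 1) (4 * p) (by simp [moves]) (by omega) (by omega)
  · exact key 7 (p + 17) (4 * p + 2) (by simp [moves]) (by omega) (by omega)

theorem near_of_reach (hA : IsGood A) {c p q : ℕ} (h : Reach A c (pt p) (pt q)) :
    near c p q = true := by
  have := h.abs_le hA
  simp only [pt, abs_eq_max_neg] at this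
  simp only [near, Bool.and_eq_true, Nat.ble_eq]
  omega

theorem testBit_lor {U V i : ℕ} : (Nat.lor U V).testBit i = (U.testBit i || V.testBit i) :=
  Nat.testBit_or U V i

theorem of_mem_walks (hA : IsGood A) {h q : ℕ} (hh : h ≤ 14) {t : Pattern} (ht : HasEdges A t.1)
    {f c p m : ℕ} {vs : List ℕ} (hm : t ∈ walks [] h q f c p m vs) :
    (∀ i, m.testBit i → t.1.testBit i) ∧ Reach A c (pt p) (pt q) := by
  induction f generalizing c p m vs with
  | zero => simp [walks] at hm
  | succ f ih =>
    rw [walks] at hm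
    cases hpq : Nat.beq p q <;> rw [hpq] at hm
    · cases hg : Nat.ble 33 p && (Nat.ble 1 (p % 16) && Nat.ble (p % 16) h) <;> rw [hg] at hm
      · simp at hm
      · simp only [Bool.and_eq_true, Nat.ble_eq] at hg
        simp only [cond_false, cond_true, List.mem_flatMap] at hm
        obtain ⟨w, hw, hm⟩ := hm
        cases hc : Nat.ble w.1 c && near (c - w.1) w.2.1 q <;> rw [hc] at hm
        · simp at hm
        · simp only [cond_true, forceNat_eq] at hm
          simp only [Bool.and_eq_true, Nat.ble_eq] at hc
          obtain ⟨h1, h2⟩ := ih hm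
          simp only [testBit_lor, Bool.or_eq_true] at h1
          refine ⟨fun i hi => h1 i (.inl hi), .step (r := pt w.2.1) (c' := c - w.1) ?_ ?_ h2⟩
          · rw [← hasEdge_moves hA hg.1 hw]
            refine ht _ (index_moves hg.1 hg.2.1 hw).1 (h1 _ (.inr ?_))
            change (1 <<< w.2.2).testBit w.2.2 = true
            simp [Nat.testBit_shiftLeft]
          · rw [moveWeight_moves hg.1 hg.2.1 (hg.2.2.trans hh) hw]
            omega
    · simp only [cond_true, List.mem_singleton] at hm
      subst hm
      rw [Nat.eq_of_beq_eq_true hpq]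
      exact ⟨fun _ hi => hi, .refl _ _⟩

theorem exists_mem_walks (hA : IsGood A) {h q : ℕ} (hh : h ≤ 14) {f c p m : ℕ} {vs : List ℕ}
    (hm : HasPattern A h m) (hr : Reach A c (pt p) (pt q)) :
    ∃ t ∈ walks [(0, [])] h q f c p m vs, HasPattern A h t.1 := by
  induction f generalizing c p m vs with
  | zero => exact ⟨(0, []), by simp [walks], hasPattern_zero h⟩
  | succ f ih =>
    rw [walks]
    cases hpq : Nat.beq p q
    · cases hg : Nat.ble 33 p && (Nat.ble 1 (p % 16) && Nat.ble (p % 16) h)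
      · exact ⟨(0, []), by simp, hasPattern_zero h⟩
      · simp only [Bool.and_eq_true, Nat.ble_eq] at hg
        generalize ha : pt p = a at hr
        generalize hb : pt q = b at hr
        cases hr with
        | refl =>
          rw [← hb] at ha
          rw [pt_injective ha] at hpq
          simp at hpq
        | @step _ c' _ r _ hpr hc hr =>
          subst ha hb
          obtain ⟨w, hw, rfl⟩ := exists_mem_moves hg.1 hg.2.1 (hg.2.2.trans hh) (hA.king hpr)
          rw [moveWeight_moves hg.1 hg.2.1 (hg.2.2.trans hh) hw] at hc
          have hr' : Reach A (c - w.1) (pt w.2.1) (pt q) := hr.mono (by omega)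
          have hm' : HasPattern A h (Nat.lor m (Nat.shiftLeft 1 w.2.2)) := by
            intro i hi
            rw [testBit_lor, Bool.or_eq_true] at hi
            rcases hi with hi | hi
            · exact hm i hi
            · rw [testBit_one_shiftLeft hi]
              obtain ⟨h1, h2⟩ := index_moves hg.1 hg.2.1 hw
              exact ⟨h1, h2.trans hg.2.2, (hasEdge_moves hA hg.1 hw).2 hpr⟩
          obtain ⟨t, ht, hp⟩ := ih (vs := p :: vs) hm' hr'
          refine ⟨t, ?_, hp⟩
          simp only [cond_false, cond_true, List.mem_flatMap]
          refine ⟨w, hw, ?_⟩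
          have hwc : Nat.ble w.1 c = true := by rw [Nat.ble_eq]; omega
          simpa only [near_of_reach hA hr', hwc, Bool.and_self, cond_true, forceNat_eq] using ht
    · exact ⟨(m, p :: vs), by simp, hm⟩

theorem exists_mem_of_mem_constraintTable (hA : IsGood A) {l : List Pattern}
    (hl : l ∈ constraintTable) : ∃ t ∈ l, HasPattern A 5 t.1 := by
  rw [constraintTable, List.mem_map] at hl
  obtain ⟨d, hd, rfl⟩ := hl
  have hr : Reach A d.2 (pt 82) (pt d.1) := by
    have h1 (q : ℕ) (h : distSq (pt 82) (pt q) = 1) := hA.reach_one h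
    have h2 (q : ℕ) (h : distSq (pt 82) (pt q) = 2) := hA.reach_two h
    have h5 (q : ℕ) (h : distSq (pt 82) (pt q) = 5) := hA.reach_five h
    simp only [List.mem_cons, List.not_mem_nil, or_false] at hd
    rcases hd with rfl | rfl | rfl | rfl | rfl | rfl | rfl | rfl
    exacts [h1 _ (by decide), h1 _ (by decide), h2 _ (by decide), h2 _ (by decide),
      h5 _ (by decide), h5 _ (by decide), h5 _ (by decide), h5 _ (by decide)]
  obtain ⟨t, ht, hp⟩ := exists_mem_walks hA (f := 6) (vs := []) (by norm_num) (hasPattern_zero 5) hr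
  exact exists_mem_prune hA ⟨t, .inl ht, hp⟩

theorem exists_mem_constraintTable_getD (hA : IsGood A) (k : ℕ) :
    ∃ t ∈ constraintTable.getD k [(0, [])], HasPattern A 5 t.1 := by
  rw [List.getD_eq_getElem?_getD]
  cases h : constraintTable[k]? with
  | none => exact ⟨(0, []), by simp, hasPattern_zero 5⟩
  | some l => exact exists_mem_of_mem_constraintTable hA (List.mem_of_getElem? h)

theorem hasEdge_add {i s : ℕ} (h : i / 4 % 16 + s % 16 + 1 < 16) :
    HasEdge (fun p q => A (p + pt s) (q + pt s)) i ↔ HasEdge A (i + 4 * s) := by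
  have h1 : (i + 4 * s) % 4 = i % 4 := by omega
  have h2 : (i + 4 * s) / 4 = i / 4 + s := by omega
  have h3 : edgeEnds (i + 4 * s) = ((edgeEnds i).1 + s, (edgeEnds i).2 + s) := by
    have h : i % 4 < 4 := Nat.mod_lt _ (by norm_num)
    generalize hk : i % 4 = k at h h1
    interval_cases k <;> simp only [edgeEnds, h1, h2, hk, Nat.add_right_comm]
  have h4 : (edgeEnds i).1 % 16 + s % 16 < 16 ∧ (edgeEnds i).2 % 16 + s % 16 < 16 := by
    simp only [edgeEnds]
    split <;> (simp only; omega)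
  rw [HasEdge, HasEdge, h3, pt_add h4.1, pt_add h4.2]

theorem exists_shifted_pattern (hA : IsGood A) (k : ℕ) {s : ℕ} (hs : s % 16 ≤ 9) :
    ∃ t ∈ constraintTable.getD k [(0, [])], HasEdges A (Nat.shiftLeft t.1 (Nat.mul 4 s)) := by
  obtain ⟨h1, h2, h3, h4⟩ := isometry_props (φ := fun p => p + pt s) (u := (pt s).1) (v := (pt s).2)
    (e := 1) (f := 1) rfl rfl (.inl fun p => by simp [Prod.ext_iff, add_comm])
  obtain ⟨t, ht, hp⟩ := exists_mem_constraintTable_getD (hA.comp h1 h2 h3 h4) k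
  refine ⟨t, ht, fun i _ hi => ?_⟩
  change (t.1 <<< (4 * s)).testBit i = true at hi
  rw [Nat.testBit_shiftLeft, Bool.and_eq_true, decide_eq_true_eq] at hi
  obtain ⟨h5, h6, h7⟩ := hp _ hi.2
  rwa [hasEdge_add (by omega), Nat.sub_add_cancel hi.1] at h7

theorem hasEdges_commonEdges (hA : IsGood A) {blk : List Pattern}
    (hblk : ∀ b ∈ blk, ¬ HasEdges A b.1) {T F s : ℕ} (hT : HasEdges A T) (hF : AvoidsEdges A F)
    {l : List Pattern} (hl : ∃ t ∈ l, HasEdges A (Nat.shiftLeft t.1 (Nat.mul 4 s))) :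
    HasEdges A (commonEdges blk T F s l) := by
  obtain ⟨t, ht, hp⟩ := hl
  have hcons (u : Pattern) (l : List Pattern) : commonEdges blk T F s (u :: l) =
      bif isViable blk F (scramble (Nat.lor T (Nat.shiftLeft u.1 (Nat.mul 4 s)))) s u.2
        then Nat.land (scramble (Nat.lor T (Nat.shiftLeft u.1 (Nat.mul 4 s))))
          (commonEdges blk T F s l)
        else commonEdges blk T F s l := by
    rw [← forceNat_eq (scramble (Nat.lor T (Nat.shiftLeft u.1 (Nat.mul 4 s))))
      fun U => bif isViable blk F U s u.2 then Nat.land U (commonEdges blk T F s l)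
        else commonEdges blk T F s l]
    rfl
  have hland (U V i : ℕ) : (Nat.land U V).testBit i = (U.testBit i && V.testBit i) :=
    Nat.testBit_and U V i
  have hU := hasEdges_scramble (hT.lor hp)
  induction l with
  | nil => simp at ht
  | cons u l ih =>
    rw [hcons]
    rw [List.mem_cons] at ht
    rcases ht with rfl | ht
    · rw [isViable_of_hasEdges hA hblk hF hU]
      intro i hi h
      rw [cond_true, hland, Bool.and_eq_true] at h
      exact hU i hi h.1
    · cases isViable blk F (scramble (Nat.lor T (Nat.shiftLeft u.1 (Nat.mul 4 s)))) s u.2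
      · exact ih ht
      · intro i hi h
        rw [cond_true, hland, Bool.and_eq_true] at h
        exact ih ht i hi h.2

theorem not_hasEdges_of_refutes (hA : IsGood A) {blk : List Pattern}
    (hblk : ∀ b ∈ blk, ¬ HasEdges A b.1) {l : List Step} {st : List (ℕ × ℕ)}
    (h : refutes constraintTable blk l st = true) {b : ℕ × ℕ} (hb : b ∈ st) :
    ¬ (HasEdges A b.1 ∧ AvoidsEdges A b.2) := by
  induction l generalizing st b with
  | nil =>
    have : st = [] := List.isEmpty_iff.1 h
    simp [this] at hb
  | cons o l ih =>
    replace h : runStep constraintTable blk o (refutes constraintTable blk l) st = true := h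
    obtain _ | ⟨⟨T, F⟩, st⟩ := st
    · simp at hb
    rw [List.mem_cons] at hb
    cases o with
    | close =>
      simp only [runStep, Bool.and_eq_true] at h
      rcases hb with rfl | hb
      · rintro ⟨h1, -⟩
        rw [h1.not_hasCrossing hA] at h
        simp at h
      · exact ih h.2 hb
    | branch i =>
      simp only [runStep, forceNat_eq, Bool.and_eq_true, Nat.ble_eq] at h
      rcases hb with rfl | hb
      · rintro ⟨hT, hF⟩
        by_cases he : HasEdge A i
        · exact ih h.2 List.mem_cons_self ⟨hasEdges_scramble (hT.lor he.hasEdges), hF⟩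
        · refine ih h.2 (List.mem_cons_of_mem _ List.mem_cons_self) ⟨hT, fun j hj => ?_⟩
          rw [testBit_lor, Bool.or_eq_true] at hj
          rcases hj with hj | hj
          · exact hF j hj
          · rw [testBit_one_shiftLeft hj]
            exact ⟨h.1, he⟩
      · exact ih h.2 (List.mem_cons_of_mem _ (List.mem_cons_of_mem _ hb))
    | use k s =>
      simp only [runStep, forceNat_eq, Bool.and_eq_true, Nat.ble_eq] at h
      rcases hb with rfl | hb
      · rintro ⟨hT, hF⟩
        exact ih h.2 List.mem_cons_self
          ⟨hasEdges_scramble (hasEdges_commonEdges hA hblk hT hF (exists_shifted_pattern hA k h.1)), hF⟩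
      · exact ih h.2 (List.mem_cons_of_mem _ hb)

theorem mem_viableStarts (hA : IsGood A) {blk : List Pattern}
    (hblk : ∀ b ∈ blk, ¬ HasEdges A b.1) {s : ℕ} {l : List Pattern} {t : Pattern} (ht : t ∈ l)
    (hp : HasEdges A (Nat.shiftLeft t.1 (Nat.mul 4 s))) :
    Nat.shiftLeft t.1 (Nat.mul 4 s) ∈ viableStarts blk s l := by
  induction l with
  | nil => simp at ht
  | cons u l ih =>
    rw [viableStarts, forceNat_eq]
    rw [List.mem_cons] at ht
    rcases ht with rfl | ht
    · rw [isViable_of_hasEdges hA hblk avoidsEdges_zero hp]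
      exact List.mem_cons_self
    · cases isViable blk 0 (Nat.shiftLeft u.1 (Nat.mul 4 s)) s u.2
      · exact ih ht
      · exact List.mem_cons_of_mem _ (ih ht)

theorem not_refutes_starts (hA : IsGood A) {blk : List Pattern}
    (hblk : ∀ b ∈ blk, ¬ HasEdges A b.1) {s : ℕ} {l : List Pattern}
    (hl : ∃ t ∈ l, HasEdges A (Nat.shiftLeft t.1 (Nat.mul 4 s))) {o : List Step} :
    ¬ refutes constraintTable blk o ((viableStarts blk s l).map fun T => (T, 0)) = true := by
  intro h
  obtain ⟨t, ht, hp⟩ := hl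
  exact not_hasEdges_of_refutes hA hblk h
    (List.mem_map_of_mem (f := fun T => (T, 0)) (mem_viableStarts hA hblk ht hp))
    ⟨hp, avoidsEdges_zero⟩

theorem IsGood.reach_pt (hA : IsGood A) : Reach A 22 (pt 150) (pt 168) := by
  by_contra hn
  have hblk : ∀ b ∈ blockedPatterns, ¬ HasEdges A b.1 := by
    intro b hb h
    rcases mem_of_mem_prune hb with hb | hb
    · exact hn (of_mem_walks hA (by norm_num) h hb).2
    · simp at hb
  have hc := checkAll_eq_true
  rw [checkAll, forceTable_eq, forcePatterns_eq, forceNats_eq] at hc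
  exact not_refutes_starts hA hblk (exists_shifted_pattern hA 4 (s := 68) (by norm_num)) hc

/-- In a locally optimal graph, a knight's move can be replaced by a walk of weight at most `22`. -/
theorem IsGood.reach_of_distSq_eq_five (hA : IsGood A) {p q : ℤ × ℤ} (h : distSq p q = 5) :
    Reach A 22 p q := by
  obtain ⟨x, y⟩ := p
  obtain ⟨z, w⟩ := q
  obtain ⟨d, rfl⟩ : ∃ d, z = x + d := ⟨z - x, by ring⟩
  obtain ⟨g, rfl⟩ : ∃ g, w = y + g := ⟨w - y, by ring⟩
  simp only [distSq, sub_add_cancel_left, neg_sq] at h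
  have key1 (e f : ℤ) (he : e ^ 2 = 1) (hf : f ^ 2 = 1) :
      Reach A 22 (x, y) (x + e * 2, y + f * 1) := by
    obtain ⟨h1, h2, h3, h4⟩ := isometry_props
      (φ := fun p => (x - e * 6 + e * p.1, y - f * 9 + f * p.2)) he hf (.inl fun p => rfl)
    have := (hA.comp h1 h2 h3 h4).reach_pt.of_comp h1
    simp only [pt] at this
    convert this using 2 <;> push_cast <;> ring
  have key2 (e f : ℤ) (he : e ^ 2 = 1) (hf : f ^ 2 = 1) :
      Reach A 22 (x, y) (x + e * 1, y + f * 2) := by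
    obtain ⟨h1, h2, h3, h4⟩ := isometry_props
      (φ := fun p => (x - e * 9 + e * p.2, y - f * 6 + f * p.1)) he hf (.inr fun p => rfl)
    have := (hA.comp h1 h2 h3 h4).reach_pt.of_comp h1
    simp only [pt] at this
    convert this using 2 <;> push_cast <;> ring
  have hd : -2 ≤ d ∧ d ≤ 2 := by constructor <;> nlinarith [sq_nonneg g]
  have hg : -2 ≤ g ∧ g ≤ 2 := by constructor <;> nlinarith [sq_nonneg d]
  obtain ⟨hd1, hd2⟩ := hd
  obtain ⟨hg1, hg2⟩ := hg
  interval_cases d <;> interval_cases g <;> norm_num at h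
  exacts [key1 (-1) (-1) rfl rfl, key1 (-1) 1 rfl rfl, key2 (-1) (-1) rfl rfl, key2 (-1) 1 rfl rfl,
    key2 1 (-1) rfl rfl, key2 1 1 rfl rfl, key1 1 (-1) rfl rfl, key1 1 1 rfl rfl]

end

/-- Properties of the adjacency relation of a plane graph of maximum degree at most `3` in which
lattice points at distance `1` have graph distance at most `1 + √2`. -/
structure IsTight (A : ℤ × ℤ → ℤ × ℤ → Prop) : Prop where
  symm : ∀ {p q}, A p q → A q p
  ne : ∀ {p q}, A p q → p ≠ q
  degree : ∀ p (l : List (ℤ × ℤ)), l.Nodup → (∀ r ∈ l, A p r) → l.length ≤ 3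
  cross : ∀ {p q r s} (N m k : ℤ), A p q → A r s → 0 < m → m < N → 0 ≤ k → k ≤ N →
    (N - m) • p + m • q = (N - k) • r + k • s → p = r ∧ q = s ∨ p = s ∧ q = r
  unit : ∀ {p q}, distSq p q = 1 → A p q ∨ ∃ r, A p r ∧ A r q ∧
    (distSq p r = 1 ∧ distSq r q = 2 ∨ distSq p r = 2 ∧ distSq r q = 1)

namespace IsTight

variable {A : ℤ × ℤ → ℤ × ℤ → Prop}

theorem comp (hA : IsTight A) {φ : ℤ × ℤ → ℤ × ℤ}
    (hd : ∀ p q, distSq (φ p) (φ q) = distSq p q) (hs : φ.Surjective) (hi : φ.Injective)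
    (ha : ∀ (N m k : ℤ) p q r s, (N - m) • p + m • q = (N - k) • r + k • s →
      (N - m) • φ p + m • φ q = (N - k) • φ r + k • φ s) :
    IsTight fun p q => A (φ p) (φ q) where
  symm h := hA.symm h
  ne h e := hA.ne h (congrArg φ e)
  degree p l hl h := by
    have := hA.degree (φ p) (l.map φ) (hl.map hi) (List.forall_mem_map.2 h)
    simpa using this
  cross N m k h h' h1 h2 h3 h4 e := by
    simpa only [hi.eq_iff] using hA.cross N m k h h' h1 h2 h3 h4 (ha _ _ _ _ _ _ _ e)
  unit {p q} h := by
    rcases hA.unit ((hd p q).trans h) with h | ⟨r, h⟩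
    · exact .inl h
    · obtain ⟨r, rfl⟩ := hs r
      simp only [hd] at h
      exact .inr ⟨r, h⟩

theorem exists_adj (hA : IsTight A) (v : ℤ × ℤ) : ∃ w, A v w := by
  rcases hA.unit (p := v) (q := v + (1, 0)) (by simp [distSq]) with h | ⟨r, h, -⟩
  exacts [⟨_, h⟩, ⟨_, h⟩]

/-- An edge does not pass through a lattice point. -/
theorem not_interior (hA : IsTight A) {p q v : ℤ × ℤ} (h : A p q) {N m : ℤ} (h1 : 0 < m)
    (h2 : m < N) : N • v ≠ (N - m) • p + m • q := by
  intro e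
  obtain ⟨w, hw⟩ := hA.exists_adj v
  have hpq := hA.ne h
  obtain ⟨a, b⟩ := p
  obtain ⟨c, d⟩ := q
  rcases hA.cross N m 0 h hw h1 h2 le_rfl (h1.trans h2).le (by simpa using e.symm) with
    ⟨rfl, rfl⟩ | ⟨rfl, rfl⟩ <;>
  simp only [Prod.smul_mk, smul_eq_mul, Prod.mk_add_mk, Prod.mk.injEq] at e
  · refine hpq (Prod.ext (mul_left_cancel₀ h1.ne' ?_) (mul_left_cancel₀ h1.ne' ?_))
    · linear_combination e.1
    · linear_combination e.2
  · have h3 : N - m ≠ 0 := by omega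
    refine hpq (Prod.ext (mul_left_cancel₀ h3 ?_) (mul_left_cancel₀ h3 ?_))
    · linear_combination -e.1
    · linear_combination -e.2

theorem eq_of_adj (hA : IsTight A) {v x y z w : ℤ × ℤ} (hx : A v x) (hy : A v y) (hz : A v z)
    (hxy : x ≠ y) (hxz : x ≠ z) (hyz : y ≠ z) (hw : A v w) : w = x ∨ w = y ∨ w = z := by
  by_contra! h
  have := hA.degree v [w, x, y, z] (by simp [h.1, h.2.1, h.2.2, hxy, hxz, hyz])
    (by simp [hx, hy, hz, hw])
  simp at this

/-- If `x`, `y`, `z` are the neighbours of `v`, then every lattice point at distance `1` from `v`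
can be served by them. -/
theorem unit_of_three (hA : IsTight A) {v x y z u : ℤ × ℤ} (hx : A v x) (hy : A v y) (hz : A v z)
    (hxy : x ≠ y) (hxz : x ≠ z) (hyz : y ≠ z) (hu : distSq v u = 1) :
    ∃ r, (r = x ∨ r = y ∨ r = z) ∧ distSq v r ≤ 2 ∧ distSq r u ≤ 2 := by
  rcases hA.unit hu with h | ⟨r, h, -, h'⟩
  · exact ⟨u, hA.eq_of_adj hx hy hz hxy hxz hyz h, by omega, by simp [distSq]⟩
  · exact ⟨r, hA.eq_of_adj hx hy hz hxy hxz hyz h, by omega, by omega⟩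

theorem not_adj_zero (hA : IsTight A) {a b : ℤ} (hb : 0 ≤ b) (hba : b ≤ a) (ha : 2 ≤ a) :
    ¬ A (0, 0) (a, b) := by
  intro h
  have no_cross {r s : ℤ × ℤ} (N m k : ℤ) (hrs : A r s) (h1 : 0 < m) (h2 : m < N) (h3 : 0 ≤ k)
      (h4 : k ≤ N) (e1 : m * a = (N - k) * r.1 + k * s.1) (e2 : m * b = (N - k) * r.2 + k * s.2)
      (hr : r ≠ (0, 0)) (hs : s ≠ (0, 0)) : False := by
    rcases hA.cross N m k h hrs h1 h2 h3 h4 (Prod.ext (by simpa using e1) (by simpa using e2)) with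
      h | h
    · exact hr h.1.symm
    · exact hs h.1.symm
  have no_interior (x y N : ℤ) (h2 : 1 < N) (e1 : N * x = a) (e2 : N * y = b) : False :=
    hA.not_interior (v := (x, y)) h one_pos h2 (Prod.ext (by simpa using e1) (by simpa using e2))
  rcases hb.eq_or_lt with rfl | hb
  · exact no_interior 1 0 a (by omega) (by ring) (by ring)
  rcases hba.eq_or_lt with rfl | hba
  · exact no_interior 1 1 b (by omega) (by ring) (by ring)
  rcases hA.unit (p := (1, 0)) (q := (1, 1)) rfl with h' | ⟨⟨x, y⟩, h1, h2, h3⟩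
  · exact no_cross a 1 b h' one_pos (by omega) hb.le hba.le (by ring) (by ring) (by simp) (by simp)
  have hx : 0 ≤ x ∧ x ≤ 2 := by
    simp only [distSq] at h3
    constructor <;> rcases h3 with h3 | h3 <;> nlinarith [sq_nonneg y, sq_nonneg (y - 1)]
  have hy : 0 ≤ y ∧ y ≤ 1 := by
    simp only [distSq] at h3
    constructor <;> rcases h3 with h3 | h3 <;> nlinarith [sq_nonneg (x - 1)]
  obtain ⟨hx1, hx2⟩ := hx
  obtain ⟨hy1, hy2⟩ := hy
  interval_cases x <;> interval_cases y <;> norm_num [distSq] at h3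
  · obtain ⟨r, hr, hr1, hr2⟩ := hA.unit_of_three (u := (-1, 0)) (hA.symm h1) h2 h (by simp)
      (by simp; omega) (by simp; omega) rfl
    rcases hr with rfl | rfl | rfl <;> simp [distSq] at hr1 hr2
    nlinarith
  · exact no_cross (a + b) 1 b h1 one_pos (by omega) hb.le (by omega) (by simp) (by simp)
      (by simp) (by simp)
  · exact no_cross (a + b) 2 (2 * b) h2 two_pos (by omega) (by omega) (by omega)
      (by simp only; ring) (by simp only; ring) (by simp) (by simp)
  · rcases lt_trichotomy (2 * b) a with hab | hab | hab
    · exact no_cross (a - b) 1 b h1 one_pos (by omega) hb.le (by omega) (by simp only; ring)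
        (by simp only; ring) (by simp) (by simp)
    · rcases (show 1 ≤ b from hb).eq_or_lt with rfl | hb
      · obtain rfl : a = 2 := by omega
        obtain ⟨r, hr, hr1, hr2⟩ := hA.unit_of_three (u := (3, 1)) (hA.symm h1) h2 (hA.symm h)
          (by simp) (by simp) (by simp) rfl
        rcases hr with rfl | rfl | rfl <;> simp [distSq] at hr1 hr2
      · exact no_interior 2 1 b hb (by omega) (by omega)
    · exact no_cross b 1 (b - (a - b)) h2 one_pos (by omega) (by omega) (by omega)
        (by simp only; ring) (by simp only; ring) (by simp) (by simp)

/-- All edges are unit edges or diagonals of unit squares. -/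
theorem king (hA : IsTight A) {p q : ℤ × ℤ} (h : A p q) : distSq p q = 1 ∨ distSq p q = 2 := by
  obtain ⟨x, y⟩ := p
  obtain ⟨z, w⟩ := q
  obtain ⟨d, rfl⟩ : ∃ d, z = x + d := ⟨z - x, by ring⟩
  obtain ⟨g, rfl⟩ : ∃ g, w = y + g := ⟨w - y, by ring⟩
  have sign (d : ℤ) : ∃ e : ℤ, e ^ 2 = 1 ∧ d = e * |d| := by
    rcases abs_cases d with h | h
    · exact ⟨1, rfl, by omega⟩
    · exact ⟨-1, rfl, by omega⟩
  obtain ⟨e, he, hd⟩ := sign d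
  obtain ⟨f, hf, hg⟩ := sign g
  have key : |d| ≤ 1 ∧ |g| ≤ 1 := by
    by_contra hn
    rcases le_total |g| |d| with hdg | hdg
    · obtain ⟨h1, h2, h3, h4⟩ := isometry_props
        (φ := fun p => (x + e * p.1, y + f * p.2)) he hf (.inl fun p => rfl)
      refine (hA.comp h1 h2 h3 h4).not_adj_zero (abs_nonneg g) hdg (by omega) ?_
      simpa [← hd, ← hg] using h
    · obtain ⟨h1, h2, h3, h4⟩ := isometry_props
        (φ := fun p => (x + e * p.2, y + f * p.1)) he hf (.inr fun p => rfl)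
      refine (hA.comp h1 h2 h3 h4).not_adj_zero (abs_nonneg d) hdg (by omega) ?_
      simpa [← hd, ← hg] using h
  simp only [abs_le] at key
  obtain ⟨⟨hd1, hd2⟩, hg1, hg2⟩ := key
  have hne := hA.ne h
  simp only [distSq, sub_add_cancel_left, neg_sq]
  clear hd hg
  interval_cases d <;> interval_cases g <;> simp at hne ⊢

end IsTight

section

variable {G : SimpleGraph (ℤ × ℤ)} {p q r s : ℤ × ℤ}

theorem dist_toC (p q : ℤ × ℤ) : dist (toC p) (toC q) = √(distSq p q : ℝ) := by
  rw [Complex.dist_eq_re_im]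
  simp [toC, distSq]

theorem distSq_nonneg (p q : ℤ × ℤ) : 0 ≤ distSq p q :=
  add_nonneg (sq_nonneg _) (sq_nonneg _)

theorem distSq_pos (h : p ≠ q) : 1 ≤ distSq p q := by
  by_contra hn
  have h0 : distSq p q = 0 := by have := distSq_nonneg p q; omega
  rw [distSq] at h0
  have h1 := pow_eq_zero_iff two_ne_zero |>.1
    (by nlinarith [sq_nonneg (p.1 - q.1), sq_nonneg (p.2 - q.2)] : (p.1 - q.1) ^ 2 = 0)
  have h2 := pow_eq_zero_iff two_ne_zero |>.1
    (by nlinarith [sq_nonneg (p.1 - q.1), sq_nonneg (p.2 - q.2)] : (p.2 - q.2) ^ 2 = 0)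
  exact h (Prod.ext (by omega) (by omega))

theorem distSq_mod_two (p q r : ℤ × ℤ) :
    (distSq p q + distSq q r) % 2 = distSq p r % 2 := by
  have key (p q : ℤ × ℤ) : distSq p q % 2 = (p.1 - q.1 + (p.2 - q.2)) % 2 := by
    have h (a : ℤ) : a ^ 2 % 2 = a % 2 := by
      rcases Int.emod_two_eq_zero_or_one a with h | h <;> simp [pow_two, Int.mul_emod, h]
    rw [distSq, Int.add_emod, h, h, ← Int.add_emod]
  have h1 := key p q
  have h2 := key q r
  have h3 := key p r
  omega

theorem one_le_dist_of_adj (h : G.Adj p q) : 1 ≤ dist (toC p) (toC q) := by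
  rw [dist_toC, Real.one_le_sqrt]
  exact_mod_cast distSq_pos h.ne

theorem walkLen_append (w : G.Walk p q) (w' : G.Walk q r) :
    walkLen G (w.append w') = walkLen G w + walkLen G w' := by
  induction w with
  | nil => simp [walkLen]
  | cons h w ih => simp [walkLen, ih, add_assoc]

theorem length_le_walkLen (w : G.Walk p q) : (w.length : ℝ) ≤ walkLen G w := by
  induction w with
  | nil => simp [walkLen]
  | cons h w ih =>
    have := one_le_dist_of_adj h
    rw [walkLen, SimpleGraph.Walk.length_cons]
    push_cast
    linarith

theorem walkLen_nonneg (w : G.Walk p q) : 0 ≤ walkLen G w :=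
  (Nat.cast_nonneg _).trans (length_le_walkLen w)

theorem gdist_le_of_walk (w : G.Walk p q) {L : ℝ} (h : walkLen G w ≤ L) :
    gdist G p q ≤ ENNReal.ofReal L :=
  iInf_le_of_le w (ENNReal.ofReal_le_ofReal h)

theorem exists_walk_of_gdist_le {L M : ℝ} (h : gdist G p q ≤ ENNReal.ofReal L) (hLM : L < M)
    (hM : 0 < M) : ∃ w : G.Walk p q, walkLen G w < M := by
  have h' : gdist G p q < ENNReal.ofReal M :=
    h.trans_lt ((ENNReal.ofReal_lt_ofReal_iff hM).2 hLM)
  obtain ⟨w, hw⟩ := iInf_lt_iff.1 h'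
  exact ⟨w, (ENNReal.ofReal_lt_ofReal_iff hM).1 hw⟩

theorem gdist_self (p : ℤ × ℤ) : gdist G p p = 0 :=
  nonpos_iff_eq_zero.1 ((gdist_le_of_walk .nil (L := 0) (by simp [walkLen])).trans_eq
    ENNReal.ofReal_zero)

theorem gdist_triangle (p q r : ℤ × ℤ) : gdist G p r ≤ gdist G p q + gdist G q r := by
  rw [gdist, gdist, gdist, ENNReal.iInf_add]
  refine le_iInf fun w => ?_
  rw [ENNReal.add_iInf]
  refine le_iInf fun w' => iInf_le_of_le (w.append w') ?_
  rw [walkLen_append, ENNReal.ofReal_add (walkLen_nonneg w) (walkLen_nonneg w')]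

theorem gdist_add_nsmul_le {v : ℤ × ℤ} {L : ℝ} (hL : 0 ≤ L)
    (h : ∀ p, gdist G p (p + v) ≤ ENNReal.ofReal L) (n : ℕ) (p : ℤ × ℤ) :
    gdist G p (p + n • v) ≤ ENNReal.ofReal (n * L) := by
  induction n with
  | zero => simp [gdist_self]
  | succ n ih =>
    refine (gdist_triangle p (p + n • v) _).trans ?_
    rw [Nat.cast_succ, add_one_mul, ENNReal.ofReal_add (by positivity) hL, succ_nsmul, ← add_assoc]
    exact add_le_add ih (h _)

theorem gdist_add_nsmul_add_nsmul_le {v w : ℤ × ℤ} {L M : ℝ} (hL : 0 ≤ L) (hM : 0 ≤ M)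
    (hv : ∀ p, gdist G p (p + v) ≤ ENNReal.ofReal L)
    (hw : ∀ p, gdist G p (p + w) ≤ ENNReal.ofReal M) (m n : ℕ) (p : ℤ × ℤ) :
    gdist G p (p + (m • v + n • w)) ≤ ENNReal.ofReal (m * L + n * M) := by
  refine (gdist_triangle p (p + m • v) _).trans ?_
  rw [ENNReal.ofReal_add (by positivity) (by positivity), ← add_assoc]
  exact add_le_add (gdist_add_nsmul_le hL hv m p) (gdist_add_nsmul_le hM hw n _)

/-- The distance bound for all pairs of lattice points follows from distance bounds for unit steps,
diagonals, and knight's moves. -/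
theorem gdist_le_of_steps {x y : ℤ × ℤ}
    (h1 : ∀ p, gdist G p (p + x) ≤ ENNReal.ofReal (1 + √2))
    (h2 : ∀ p, gdist G p (p + (x + y)) ≤ ENNReal.ofReal (2 + √2))
    (h5 : ∀ p, gdist G p (p + (2 • x + y)) ≤ ENNReal.ofReal (3 + √2))
    {a b : ℕ} (hba : b ≤ a) (p : ℤ × ℤ) :
    gdist G p (p + (a • x + b • y)) ≤ ENNReal.ofReal ((1 + √2) * √(a ^ 2 + b ^ 2 : ℝ)) := by
  have hs : √2 ^ 2 = 2 := Real.sq_sqrt (by norm_num)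
  have hs0 : 0 ≤ √2 := Real.sqrt_nonneg 2
  have hba' : (b : ℝ) ≤ a := by exact_mod_cast hba
  have ha : (0 : ℝ) ≤ a := by positivity
  have hb : (0 : ℝ) ≤ b := by positivity
  rcases le_total (2 * b) a with hab | hab
  · obtain ⟨c, rfl⟩ := Nat.exists_eq_add_of_le hab
    rw [show (2 * b + c) • x + b • y = b • (2 • x + y) + c • x by
      rw [add_smul, mul_comm, mul_smul, smul_add]; abel]
    refine (gdist_add_nsmul_add_nsmul_le (by positivity) (by positivity) h5 h1 b c p).trans
      (ENNReal.ofReal_le_ofReal ?_)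
    have h : ((2 * b + c : ℕ) : ℝ) ≤ √(((2 * b + c : ℕ) : ℝ) ^ 2 + (b : ℝ) ^ 2) :=
      Real.le_sqrt_of_sq_le (by nlinarith)
    have h' : 1 ≤ √2 := by rw [Real.one_le_sqrt]; norm_num
    have := mul_le_mul_of_nonneg_left h (by positivity : 0 ≤ 1 + √2)
    push_cast at this ⊢
    nlinarith
  · obtain ⟨c, rfl⟩ := Nat.exists_eq_add_of_le hba
    obtain ⟨d, hd⟩ : ∃ d, b = c + d := ⟨b - c, by omega⟩
    rw [show (b + c) • x + b • y = c • (2 • x + y) + d • (x + y) by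
      rw [hd]; simp only [add_smul, smul_add, two_smul]; abel]
    refine (gdist_add_nsmul_add_nsmul_le (by positivity) (by positivity) h5 h2 c d p).trans
      (ENNReal.ofReal_le_ofReal ?_)
    have hbd : (b : ℝ) = c + d := by exact_mod_cast hd
    have hc : (0 : ℝ) ≤ c := by positivity
    have h' : 1 ≤ √2 := by rw [Real.one_le_sqrt]; norm_num
    have h : ((b + c : ℕ) : ℝ) * (√2 - 1) + b ≤ √(((b + c : ℕ) : ℝ) ^ 2 + (b : ℝ) ^ 2) := by
      apply Real.le_sqrt_of_sq_le
      have := mul_nonneg (mul_nonneg (sub_nonneg.2 h') ha) (sub_nonneg.2 hba')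
      linear_combination 2 * this + ((b + c : ℕ) : ℝ) ^ 2 * hs
    have := mul_le_mul_of_nonneg_left h (by positivity : 0 ≤ 1 + √2)
    push_cast at this ⊢
    linear_combination this - (b + c : ℝ) * hs - (2 + √2) * hbd

theorem sqrt_two_bounds : √2 < 1.4143 ∧ 1.4142 < √2 := by
  constructor
  · rw [Real.sqrt_lt' (by norm_num)]; norm_num
  · rw [Real.lt_sqrt (by norm_num)]; norm_num

theorem _root_.IsPlane.cross (hG : IsPlane G) (hpq : G.Adj p q) (hrs : G.Adj r s) {N m k : ℤ}
    (h0 : 0 < m) (hm : m < N) (hk : 0 ≤ k) (hk' : k ≤ N)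
    (e : (N - m) • p + m • q = (N - k) • r + k • s) : p = r ∧ q = s ∨ p = s ∧ q = r := by
  by_contra hn
  have hne : s(p, q) ≠ s(r, s) := by rwa [Ne, Sym2.eq_iff]
  have hN : (0 : ℝ) < N := by exact_mod_cast h0.trans hm
  have h0' : (0 : ℝ) < m := by exact_mod_cast h0
  have hm' : (m : ℝ) < N := by exact_mod_cast hm
  have hseg (a b : ℤ × ℤ) (k : ℤ) (h1 : 0 ≤ k) (h2 : k ≤ N) :
      (⟨((N - k) * a.1 + k * b.1 : ℝ) / N, ((N - k) * a.2 + k * b.2 : ℝ) / N⟩ : ℂ) ∈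
        segment ℝ (toC a) (toC b) := by
    have h1' : (0 : ℝ) ≤ k := by exact_mod_cast h1
    have h2' : (k : ℝ) ≤ N := by exact_mod_cast h2
    refine ⟨(N - k) / N, k / N, div_nonneg (sub_nonneg.2 h2') hN.le, div_nonneg h1' hN.le,
      by field_simp; ring, ?_⟩
    apply Complex.ext <;> simp [toC] <;> field_simp
  have e1 : ((N - m) * p.1 + m * q.1 : ℝ) = (N - k) * r.1 + k * s.1 := by
    exact_mod_cast congrArg Prod.fst e
  have e2 : ((N - m) * p.2 + m * q.2 : ℝ) = (N - k) * r.2 + k * s.2 := by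
    exact_mod_cast congrArg Prod.snd e
  have h := hG p q r s hpq hrs hne _ (hseg p q m h0.le hm.le) (by
    rw [e1, e2]
    exact hseg r s k hk hk')
  rcases h.1 with h | h
  · have h1 := congrArg Complex.re h
    have h2 := congrArg Complex.im h
    simp only [toC, div_eq_iff hN.ne'] at h1 h2
    refine hpq.ne (Prod.ext ?_ ?_)
    · have : (p.1 : ℝ) = q.1 := mul_left_cancel₀ h0'.ne' (by linear_combination -h1)
      exact_mod_cast this
    · have : (p.2 : ℝ) = q.2 := mul_left_cancel₀ h0'.ne' (by linear_combination -h2)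
      exact_mod_cast this
  · have h1 := congrArg Complex.re h
    have h2 := congrArg Complex.im h
    simp only [toC, div_eq_iff hN.ne'] at h1 h2
    have hmN : (N - m : ℝ) ≠ 0 := (sub_pos.2 hm').ne'
    refine hpq.ne (Prod.ext ?_ ?_)
    · have : (p.1 : ℝ) = q.1 := mul_left_cancel₀ hmN (by linear_combination h1)
      exact_mod_cast this
    · have : (p.2 : ℝ) = q.2 := mul_left_cancel₀ hmN (by linear_combination h2)
      exact_mod_cast this

theorem _root_.MaxDegThree.length_le (hG : MaxDegThree G) (v : ℤ × ℤ) (l : List (ℤ × ℤ)) (hl : l.Nodup)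
    (h : ∀ r ∈ l, G.Adj v r) : l.length ≤ 3 := by
  have h1 : ((l.toFinset : Set (ℤ × ℤ))).encard ≤ 3 :=
    (Set.encard_le_encard fun r hr => h r (by simpa using hr)).trans (hG v)
  rw [Set.encard_coe_eq_coe_finsetCard, List.toFinset_card_of_nodup hl] at h1
  exact_mod_cast h1

theorem adj_or_of_walkLen_lt (hpq : distSq p q = 1) (w : G.Walk p q) (hw : walkLen G w < 2.43) :
    G.Adj p q ∨ ∃ r, G.Adj p r ∧ G.Adj r q ∧
      (distSq p r = 1 ∧ distSq r q = 2 ∨ distSq p r = 2 ∧ distSq r q = 1) := by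
  cases w with
  | nil => simp [distSq] at hpq
  | @cons _ r _ h w =>
    cases w with
    | nil => exact .inl h
    | @cons _ t _ h' w =>
      cases w with
      | nil =>
        refine .inr ⟨r, h, h', ?_⟩
        have h1 := one_le_dist_of_adj h
        have h2 := one_le_dist_of_adj h'
        simp only [walkLen, add_zero] at hw
        rw [dist_toC] at h1 h2
        rw [dist_toC, dist_toC] at hw
        have key (n : ℤ) (hn : √(n : ℝ) < 1.43) : n ≤ 2 := by
          rw [Real.sqrt_lt' (by norm_num)] at hn
          have : (n : ℝ) < 3 := hn.trans (by norm_num)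
          have : n < 3 := by exact_mod_cast this
          omega
        have h3 := key (distSq p r) (by linarith)
        have h4 := key (distSq r q) (by linarith)
        have h5 := distSq_mod_two p r q
        have h6 := distSq_pos h.ne
        have h7 := distSq_pos h'.ne
        omega
      | cons h'' w =>
        have := length_le_walkLen (.cons h (.cons h' (.cons h'' w)))
        simp only [SimpleGraph.Walk.length_cons] at this
        push_cast at this
        have h0 : (0 : ℝ) ≤ w.length := by positivity
        norm_num at hw this
        linarith

theorem one_add_sqrt_two_le_walkLen (hpq : distSq p q = 1) (hn : ¬ G.Adj p q) (w : G.Walk p q) :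
    1 + √2 ≤ walkLen G w := by
  have hs := sqrt_two_bounds
  by_contra! hw
  rcases adj_or_of_walkLen_lt hpq w (by norm_num at hs ⊢; linarith) with h | ⟨r, -⟩
  · exact hn h
  cases w with
  | nil => simp [distSq] at hpq
  | @cons _ r _ h w =>
    cases w with
    | nil => exact hn h
    | @cons _ t _ h' w =>
      have hr := one_le_dist_of_adj h
      have ht := one_le_dist_of_adj h'
      have h0 := walkLen_nonneg w
      cases w with
      | nil =>
        simp only [walkLen, add_zero] at hw
        have h5 := distSq_mod_two p r q
        have h6 := distSq_pos h.ne
        have h7 := distSq_pos h'.ne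
        have key (a b : ℤ × ℤ) (hab : 2 ≤ distSq a b) : √2 ≤ dist (toC a) (toC b) := by
          rw [dist_toC]
          exact Real.sqrt_le_sqrt (by exact_mod_cast hab)
        rcases (by omega : 2 ≤ distSq p r ∨ 2 ≤ distSq r q) with h | h
        · linarith [key _ _ h]
        · linarith [key _ _ h]
      | cons h'' w =>
        have := one_le_dist_of_adj h''
        have := walkLen_nonneg w
        simp only [walkLen] at hw
        norm_num at hs
        linarith

end

section

variable {G : SimpleGraph (ℤ × ℤ)} {p q : ℤ × ℤ}

theorem _root_.LocallyOptimal.gdist_le (hG : LocallyOptimal G) {n : ℤ} (hn : n ≤ 5)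
    (h : distSq p q = n) : gdist G p q ≤ ENNReal.ofReal ((1 + √2) * √(n : ℝ)) := by
  have h' : dist (toC p) (toC q) = √(n : ℝ) := by rw [dist_toC, h]
  rw [← h']
  refine hG.2.2 p q ?_
  rw [h']
  exact Real.sqrt_le_sqrt (by exact_mod_cast hn)

theorem _root_.LocallyOptimal.gdist_le_one (hG : LocallyOptimal G) (h : distSq p q = 1) :
    gdist G p q ≤ ENNReal.ofReal (1 + √2) := by
  simpa using hG.gdist_le (by norm_num) h

theorem _root_.LocallyOptimal.gdist_le_two (hG : LocallyOptimal G) (h : distSq p q = 2) :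
    gdist G p q ≤ ENNReal.ofReal (2 + √2) := by
  have h2 := hG.gdist_le (by norm_num) h
  rwa [Int.cast_ofNat, add_mul, one_mul, Real.mul_self_sqrt zero_le_two, add_comm] at h2

theorem _root_.LocallyOptimal.isTight (hG : LocallyOptimal G) : IsTight G.Adj where
  symm h := h.symm
  ne h := h.ne
  degree p l hl h := hG.2.1.length_le p l hl h
  cross _ _ _ h h' h1 h2 h3 h4 e := hG.1.cross h h' h1 h2 h3 h4 e
  unit {p q} h := by
    have hs := sqrt_two_bounds
    obtain ⟨w, hw⟩ := exists_walk_of_gdist_le (hG.gdist_le_one h) (M := 2.43)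
      (by norm_num at hs ⊢; linarith) (by norm_num)
    exact adj_or_of_walkLen_lt h w hw

theorem five_mul_dist (hG : IsTight G.Adj) (h : G.Adj p q) :
    (moveWeight p q : ℝ) ≤ 5 * dist (toC p) (toC q) := by
  have hs := sqrt_two_bounds
  rw [dist_toC]
  rcases hG.king h with h | h <;> simp [moveWeight, h]
  norm_num at hs
  linarith

theorem exists_reach (hG : IsTight G.Adj) (w : G.Walk p q) :
    ∃ c, Reach G.Adj c p q ∧ (c : ℝ) ≤ 5 * walkLen G w := by
  induction w with
  | nil => exact ⟨0, .refl _ _, by simp [walkLen]⟩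
  | cons h w ih =>
    obtain ⟨c, hc, hcw⟩ := ih
    refine ⟨_, .step h le_rfl hc, ?_⟩
    have := five_mul_dist hG h
    rw [walkLen]
    push_cast
    linarith

theorem reach_of_gdist_le (hG : IsTight G.Adj) {L : ℝ} {c : ℕ}
    (h : gdist G p q ≤ ENNReal.ofReal L) (hL : 5 * L < c + 1) : Reach G.Adj c p q := by
  obtain ⟨w, hw⟩ := exists_walk_of_gdist_le h (M := (c + 1) / 5) (by linarith) (by positivity)
  obtain ⟨d, hd, hdw⟩ := exists_reach hG w
  refine hd.mono ?_
  have : (d : ℝ) < (c + 1 : ℕ) := by push_cast; linarith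
  exact Nat.lt_succ_iff.1 (by exact_mod_cast this)

theorem _root_.LocallyOptimal.isGood (hG : LocallyOptimal G) : IsGood G.Adj where
  symm h := h.symm
  king h := hG.isTight.king h
  degree p l hl h := hG.2.1.length_le p l hl h
  cross {p q r s} h h' e h1 h2 := by
    rcases hG.1.cross h h' (N := 2) (m := 1) (k := 1) one_pos one_lt_two zero_le_one one_le_two
      (by simpa using e) with h | h
    exacts [h1 h.1, h2 h.1]
  reach_one h := by
    have hs := sqrt_two_bounds
    refine reach_of_gdist_le hG.isTight (hG.gdist_le_one h) ?_
    norm_num at hs ⊢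
    linarith
  reach_two h := by
    have hs := sqrt_two_bounds
    refine reach_of_gdist_le hG.isTight (hG.gdist_le_two h) ?_
    norm_num at hs ⊢
    linarith
  reach_five h := by
    have hs := sqrt_two_bounds
    refine reach_of_gdist_le hG.isTight (hG.gdist_le le_rfl h) ?_
    have h5 : √5 < 2.2361 := by rw [Real.sqrt_lt' (by norm_num)]; norm_num
    have h0 : 0 ≤ √5 := Real.sqrt_nonneg 5
    norm_num at hs h5 ⊢
    nlinarith

/-- A king walk is made of `a` unit steps and `b` diagonals for some `a` and `b`. -/
theorem Reach.exists_walk (hG : IsGood G.Adj) {c : ℕ} (h : Reach G.Adj c p q) :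
    ∃ (w : G.Walk p q) (a b : ℕ), walkLen G w = a + b * √2 ∧ 5 * a + 7 * b ≤ c ∧
      (a : ℤ) % 2 = distSq p q % 2 := by
  induction h with
  | refl c p => exact ⟨.nil, 0, 0, by simp [walkLen], by omega, by simp [distSq]⟩
  | @step c c' p r q h hc hr ih =>
    obtain ⟨w, a, b, hw, hab, ha⟩ := ih
    have hpar := distSq_mod_two p r q
    rcases hG.king h with hd | hd
    · refine ⟨.cons h w, a + 1, b, ?_, ?_, ?_⟩
      · rw [walkLen, hw, dist_toC, hd]
        push_cast
        rw [Real.sqrt_one]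
        ring
      · simp only [moveWeight, hd] at hc
        grind
      · push_cast
        omega
    · refine ⟨.cons h w, a, b + 1, ?_, ?_, ?_⟩
      · rw [walkLen, hw, dist_toC, hd]
        push_cast
        ring
      · simp only [moveWeight, hd] at hc
        grind
      · omega

theorem _root_.LocallyOptimal.gdist_le_five (hG : LocallyOptimal G) (h : distSq p q = 5) :
    gdist G p q ≤ ENNReal.ofReal (3 + √2) := by
  obtain ⟨w, a, b, hw, hab, ha⟩ := (hG.isGood.reach_of_distSq_eq_five h).exists_walk hG.isGood
  have hs := sqrt_two_bounds
  refine gdist_le_of_walk w ?_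
  rw [hw]
  rw [h] at ha
  norm_num at hs
  rcases (by omega : a = 1 ∧ b ≤ 2 ∨ a = 3 ∧ b ≤ 1) with ⟨rfl, hb⟩ | ⟨rfl, hb⟩ <;>
    interval_cases b <;> norm_num <;> linarith

theorem _root_.LocallyOptimal.gdist_le_mul_dist (hG : LocallyOptimal G) (p q : ℤ × ℤ) :
    gdist G p q ≤ ENNReal.ofReal ((1 + √2) * dist (toC p) (toC q)) := by
  obtain ⟨x, y⟩ := p
  obtain ⟨z, t⟩ := q
  have sign (d : ℤ) : ∃ (e : ℤ) (n : ℕ), (e = 1 ∨ e = -1) ∧ d = n * e := by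
    rcases Int.natAbs_eq d with h | h
    · exact ⟨1, d.natAbs, .inl rfl, by omega⟩
    · exact ⟨-1, d.natAbs, .inr rfl, by omega⟩
  obtain ⟨e, m, he, hd⟩ := sign (z - x)
  obtain ⟨f, n, hf, hg⟩ := sign (t - y)
  obtain rfl : z = x + m * e := by omega
  obtain rfl : t = y + n * f := by omega
  have hdist : distSq (x, y) (x + m * e, y + n * f) = (m : ℤ) ^ 2 + (n : ℤ) ^ 2 := by
    rcases he with rfl | rfl <;> rcases hf with rfl | rfl <;> simp [distSq]
  rw [dist_toC, hdist]
  push_cast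
  rcases le_total n m with h | h
  · have := gdist_le_of_steps (G := G) (x := (e, 0)) (y := (0, f))
      (fun p => hG.gdist_le_one (by rcases he with rfl | rfl <;> simp [distSq]))
      (fun p => hG.gdist_le_two (by
        rcases he with rfl | rfl <;> rcases hf with rfl | rfl <;> simp [distSq]))
      (fun p => hG.gdist_le_five (by
        rcases he with rfl | rfl <;> rcases hf with rfl | rfl <;> simp [distSq]))
      h (x, y)
    simpa using this
  · have := gdist_le_of_steps (G := G) (x := (0, f)) (y := (e, 0))
      (fun p => hG.gdist_le_one (by rcases hf with rfl | rfl <;> simp [distSq]))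
      (fun p => hG.gdist_le_two (by
        rcases he with rfl | rfl <;> rcases hf with rfl | rfl <;> simp [distSq]))
      (fun p => hG.gdist_le_five (by
        rcases he with rfl | rfl <;> rcases hf with rfl | rfl <;> simp [distSq]))
      h (x, y)
    simpa [add_comm ((m : ℝ) ^ 2)] using this

theorem dist_toC_pos (h : p ≠ q) : 0 < dist (toC p) (toC q) := by
  rw [dist_toC, Real.sqrt_pos]
  exact_mod_cast distSq_pos h

theorem dil_le_iff : dil G ≤ ENNReal.ofReal (1 + √2) ↔
    ∀ p q, gdist G p q ≤ ENNReal.ofReal ((1 + √2) * dist (toC p) (toC q)) := by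
  have h0 : 0 ≤ 1 + √2 := by positivity
  simp only [dil, iSup_le_iff]
  refine forall₂_congr fun p q => ⟨fun h => ?_, fun h hpq => ?_⟩
  · rcases eq_or_ne p q with rfl | hpq
    · simp [gdist_self]
    · rw [ENNReal.ofReal_mul h0]
      refine (ENNReal.div_le_iff ?_ ENNReal.ofReal_ne_top).1 (h hpq)
      simpa using dist_toC_pos hpq
  · rw [ENNReal.ofReal_mul h0] at h
    exact ENNReal.div_le_of_le_mul h

/-- Some unit step is not an edge, and it forces the dilation to be at least `1 + √2`. -/
theorem _root_.MaxDegThree.le_dil (hG : MaxDegThree G) : ENNReal.ofReal (1 + √2) ≤ dil G := by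
  obtain ⟨q, hq, hd⟩ : ∃ q : ℤ × ℤ, ¬ G.Adj (0, 0) q ∧ distSq (0, 0) q = 1 := by
    by_contra! h
    have := hG.length_le (0, 0) [(1, 0), (0, 1), (-1, 0), (0, -1)] (by decide) (by
      intro r hr
      by_contra hn
      refine h r hn ?_
      fin_cases hr <;> rfl)
    simp at this
  have hne : ((0, 0) : ℤ × ℤ) ≠ q := by
    rintro rfl
    simp [distSq] at hd
  refine le_trans ?_ (le_iSup₂_of_le (0, 0) q (le_iSup_of_le hne le_rfl))
  rw [dist_toC, hd]
  simp only [Int.cast_one, Real.sqrt_one, ENNReal.ofReal_one, div_one]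
  exact le_iInf fun w => ENNReal.ofReal_le_ofReal (one_add_sqrt_two_le_walkLen hd hq w)

end

end LocalOptimality

/-- Local-global principle: a locally optimal graph satisfies the dilation bound for all
pairs of lattice points; consequently the locally optimal graphs are exactly the plane,
maximum-degree-3 geometric graphs on ℤ² of dilation 1+√2. -/
theorem local_global_principle :
    (∀ G : SimpleGraph (ℤ × ℤ), LocallyOptimal G →
      ∀ p q : ℤ × ℤ,
        gdist G p q ≤ ENNReal.ofReal ((1 + Real.sqrt 2) * dist (toC p) (toC q))) ∧
    {G : SimpleGraph (ℤ × ℤ) | LocallyOptimal G} =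
      {G : SimpleGraph (ℤ × ℤ) |
        IsPlane G ∧ MaxDegThree G ∧ dil G = ENNReal.ofReal (1 + Real.sqrt 2)} := by
  refine ⟨fun G hG => hG.gdist_le_mul_dist, Set.ext fun G =>
    ⟨fun hG => ⟨hG.1, hG.2.1, le_antisymm ?_ (hG.2.1.le_dil)⟩,
    fun hG => ⟨hG.1, hG.2.1, fun p q _ => LocalOptimality.dil_le_iff.1 hG.2.2.le p q⟩⟩⟩
  exact LocalOptimality.dil_le_iff.2 hG.gdist_le_mul_dist
end
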